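/- arXiv:2309.01514 — 3 statements merged into one kernel-verified Lean document; each statement's English description precedes it below -/
import Mathlib

section
/- Assume (A0), (A1), (A2) and (A3). Then equation (*) is uniformly permanent with explicit bounds: every positive solution x satisfies m ≤ liminf_{t→∞} x(t) ≤ limsup_{t→∞} x(t) ≤ M, where m = (1/a⁺)(log α)·e^{−(2D+P)} and M = (1/a⁻)(log γ)·e^{2(D+P)}. -/
open Real Filter MeasureTheory Set

noncomputable section

/-- A positive (admissible) solution of the nonautonomous Nicholson equation (*)
`x'(t) = ∑ j, p j t * x (t - τd j t) * exp (-(a j t * x (t - σd j t))) - δ t * x t`,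
considered for `t ≥ 0`, with nonnegative continuous initial data on `[-τ, 0)` and `x 0 > 0`. -/
def IsPosSol (m : ℕ) (p a : Fin m → ℝ → ℝ) (δ : ℝ → ℝ)
    (τd σd : Fin m → ℝ → ℝ) (τ : ℝ) (x : ℝ → ℝ) : Prop :=
  ContinuousOn x (Ici (-τ)) ∧
  (∀ θ ∈ Ico (-τ) (0:ℝ), 0 ≤ x θ) ∧ 0 < x 0 ∧
  ∀ t ≥ (0:ℝ), HasDerivWithinAt x
      ((∑ j, p j t * x (t - τd j t) * Real.exp (-(a j t * x (t - σd j t)))) - δ t * x t)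
      (Ici 0) t

/-- Hypothesis (A0): the coefficients `p j, a j, δ` are continuous and positive on `[0,∞)`;
the delays `τd j, σd j` are continuous, nonnegative and bounded; and each `a j` is bounded
below and above by positive constants. -/
def HypA0 (m : ℕ) (p a : Fin m → ℝ → ℝ) (δ : ℝ → ℝ)
    (τd σd : Fin m → ℝ → ℝ) : Prop :=
  (∀ j, ContinuousOn (p j) (Ici 0) ∧ ∀ t ≥ (0:ℝ), 0 < p j t) ∧
  (∀ j, ContinuousOn (a j) (Ici 0) ∧
      ∃ c C : ℝ, 0 < c ∧ ∀ t ≥ (0:ℝ), c ≤ a j t ∧ a j t ≤ C) ∧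
  (ContinuousOn δ (Ici 0) ∧ ∀ t ≥ (0:ℝ), 0 < δ t) ∧
  (∀ j, ContinuousOn (τd j) (Ici 0) ∧ ContinuousOn (σd j) (Ici 0) ∧
      (∀ t ≥ (0:ℝ), 0 ≤ τd j t ∧ 0 ≤ σd j t) ∧
      ∃ B : ℝ, ∀ t ≥ (0:ℝ), τd j t ≤ B ∧ σd j t ≤ B)

/-- `τ = max_j max (sup_t τd j t, sup_t σd j t)`: the supremum of all the delays. -/
def IsMaxDelay (m : ℕ) (τd σd : Fin m → ℝ → ℝ) (τ : ℝ) : Prop :=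
  IsLUB {r : ℝ | ∃ j : Fin m, ∃ t : ℝ, 0 ≤ t ∧ (r = τd j t ∨ r = σd j t)} τ

/-- Hypothesis (A1): `liminf_{t→∞} p(t)/δ(t) > 1` and `limsup_{t→∞} p(t)/δ(t) < ∞`. -/
def HypA1 (m : ℕ) (p : Fin m → ℝ → ℝ) (δ : ℝ → ℝ) : Prop :=
  1 < Filter.liminf (fun t => (∑ j, p j t) / δ t) Filter.atTop ∧
  Filter.IsBoundedUnder (· ≤ ·) Filter.atTop (fun t => (∑ j, p j t) / δ t)

/-- Hypothesis (A2): `limsup_{t→∞} ∫_{t-τ}^t p(s) ds < ∞`. -/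
def HypA2 (m : ℕ) (p : Fin m → ℝ → ℝ) (τ : ℝ) : Prop :=
  Filter.IsBoundedUnder (· ≤ ·) Filter.atTop (fun t => ∫ s in t - τ..t, (∑ j, p j s))

/-- Hypothesis (A3): `∫_0^∞ δ(s) ds = ∞`. -/
def HypA3 (δ : ℝ → ℝ) : Prop :=
  Filter.Tendsto (fun t => ∫ s in (0:ℝ)..t, δ s) Filter.atTop Filter.atTop

open Topology
theorem aux_cross (g : ℝ → ℝ) (s : ℝ) (hc : ContinuousOn g (Ici s)) (h0 : 0 ≤ g s)
    (h : ∀ t ≥ s, (∀ u ∈ Icc s t, 0 ≤ g u) → g t = 0 →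
      ∃ d > 0, HasDerivWithinAt g d (Ici t) t) : ∀ t ≥ s, 0 ≤ g t := by
  intro b hb
  have hcl : IsClosed ({t | 0 ≤ g t} ∩ Icc s b) := by
    have := (hc.mono (Icc_subset_Ici_self : Icc s b ⊆ Ici s)).preimage_isClosed_of_isClosed
      isClosed_Icc (isClosed_Ici (a := (0:ℝ)))
    rw [inter_comm]; exact this
  by_contra hneg
  -- first bad point
  set S := {t | t ∈ Icc s b ∧ ∀ u ∈ Icc s t, 0 ≤ g u} with hS
  have hsS : s ∈ S := ⟨⟨le_refl _, hb⟩, fun u hu => by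
    have : u = s := le_antisymm hu.2 hu.1
    rwa [this]⟩
  have hbdd : BddAbove S := ⟨b, fun t ht => ht.1.2⟩
  set c := sSup S with hcdef
  have hsc : s ≤ c := le_csSup hbdd hsS
  have hcb : c ≤ b := csSup_le ⟨s, hsS⟩ fun t ht => ht.1.2
  have hlt : ∀ u ∈ Ico s c, 0 ≤ g u := by
    intro u hu
    obtain ⟨t, ht, hut⟩ := exists_lt_of_lt_csSup ⟨s, hsS⟩ hu.2
    exact ht.2 u ⟨hu.1, hut.le⟩
  have hcmem : 0 ≤ g c := by
    rcases hsc.eq_or_lt with h | h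
    · rw [← h]; exact h0
    · have hcc : c ∈ closure (Ico s c) := by
        rw [closure_Ico h.ne]; exact ⟨hsc, le_refl _⟩
      have hsub : Ico s c ⊆ {t | 0 ≤ g t} ∩ Icc s b :=
        fun u hu => ⟨hlt u hu, hu.1, hu.2.le.trans hcb⟩
      exact (closure_minimal hsub hcl hcc).1
  have hall : ∀ u ∈ Icc s c, 0 ≤ g u := by
    intro u hu
    rcases hu.2.eq_or_lt with h | h
    · rw [h]; exact hcmem
    · exact hlt u ⟨hu.1, h⟩
  have hcb' : c < b := by
    rcases hcb.eq_or_lt with h | h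
    · exact absurd (h ▸ hcmem) hneg
    · exact h
  have hev : ∀ᶠ u in 𝓝[>] c, 0 ≤ g u := by
    rcases hcmem.eq_or_lt with h' | h'
    · obtain ⟨d, hd, hder⟩ := h c hsc hall h'.symm
      have := hasDerivWithinAt_iff_tendsto_slope.1 hder
      have h2 : ∀ᶠ u in 𝓝[Ici c \ {c}] c, 0 < slope g c u := this.eventually (lt_mem_nhds hd)
      rw [Ici_sdiff_left] at h2
      filter_upwards [h2, self_mem_nhdsWithin] with u hu huc
      rw [slope_def_field, ← h'] at hu
      have huc' : 0 < u - c := sub_pos.2 huc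
      have := (div_pos_iff_of_pos_right huc').1 hu
      linarith
    · have hcw : ContinuousWithinAt g (Ici c) c := (hc c hsc).mono (Ici_subset_Ici.2 hsc)
      have h2 := hcw.eventually (lt_mem_nhds h')
      exact (h2.filter_mono (nhdsWithin_mono _ Ioi_subset_Ici_self)).mono fun u hu => hu.le
  obtain ⟨e, he, hsub⟩ := mem_nhdsGT_iff_exists_Ioo_subset.1 hev
  have hce : c < e := he
  set w := min ((c + e) / 2) b
  have hw1 : c < w := lt_min (by linarith) hcb'
  have hw2 : w < e := (min_le_left _ _).trans_lt (by linarith)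
  have hwS : w ∈ S := by
    refine ⟨⟨hsc.trans hw1.le, min_le_right _ _⟩, fun u hu => ?_⟩
    rcases le_or_gt u c with h | h
    · exact hall u ⟨hu.1, h⟩
    · exact hsub ⟨h, hu.2.trans_lt hw2⟩
  exact absurd (le_csSup hbdd hwS) (not_le.2 hw1)

theorem aux_mono (f f' : ℝ → ℝ) (s : ℝ) (hs : 0 ≤ s)
    (hd : ∀ t ≥ (0:ℝ), HasDerivWithinAt f (f' t) (Ici 0) t)
    (h : ∀ t ≥ s, 0 ≤ f' t) : MonotoneOn f (Ici s) := by
  refine monotoneOn_of_hasDerivWithinAt_nonneg (f' := f') (convex_Ici s) ?_ ?_ ?_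
  · intro t ht
    exact ((hd t (hs.trans ht)).continuousWithinAt).mono (Ici_subset_Ici.2 hs)
  · intro t ht
    rw [interior_Ici] at ht ⊢
    exact (hd t (hs.trans (le_of_lt ht))).mono fun u hu => hs.trans (le_of_lt hu)
  · intro t ht
    rw [interior_Ici] at ht
    exact h t (le_of_lt ht)

theorem aux_descent (f f' Δ δ : ℝ → ℝ)
    (hd : ∀ t ≥ (0:ℝ), HasDerivWithinAt f (f' t) (Ici 0) t)
    (hΔ : ∀ t ≥ (0:ℝ), HasDerivAt Δ (δ t) t) (hδ : ∀ t ≥ (0:ℝ), 0 < δ t)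
    (hinf : Tendsto Δ atTop atTop) (L : ℝ) (hL : ∀ t ≥ (0:ℝ), L ≤ f t)
    (K c T : ℝ) (hT : 0 ≤ T) (hc : 0 < c) (h : ∀ t ≥ T, K ≤ f t → f' t ≤ -(c * δ t)) :
    ∃ T' ≥ (0:ℝ), ∀ t ≥ T', f t ≤ K := by
  by_cases hex : ∃ s ≥ T, f s ≤ K
  · obtain ⟨s, hs, hsK⟩ := hex
    refine ⟨s, hT.trans hs, fun t ht => ?_⟩
    have := aux_cross (fun t => K - f t) s ?_ (by simpa using hsK) ?_ t ht
    · simpa using this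
    · intro u hu
      exact (continuousWithinAt_const.sub ((hd u (hT.trans (hs.trans hu))).continuousWithinAt.mono
        (Ici_subset_Ici.2 (hT.trans hs))))
    · intro u hu _ hz
      have hu0 : 0 ≤ u := hT.trans (hs.trans hu)
      refine ⟨-f' u, ?_, ?_⟩
      · have := h u (hs.trans hu) (by linarith)
        have := mul_pos hc (hδ u hu0)
        linarith
      · exact ((hd u hu0).mono (Ici_subset_Ici.2 hu0)).const_sub K
  · push Not at hex
    exfalso
    have hm := aux_mono (fun t => -f t - c * Δ t) (fun t => -f' t - c * δ t) T hT
      (fun t ht => (hd t ht).neg.sub ((hΔ t ht).hasDerivWithinAt.const_mul c))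
      (fun t ht => by have := h t ht (hex t ht).le; linarith)
    obtain ⟨t, ht1, ht2⟩ := ((hinf.eventually_gt_atTop ((-f T - c * Δ T - (-f T - c * Δ T) * 2 - L) / c)).and (eventually_ge_atTop T)).exists
    have h1 := hm (mem_Ici.2 le_rfl) (mem_Ici.2 ht2) ht2
    have h2 := hL t (hT.trans ht2)
    rw [div_lt_iff₀ hc] at ht1
    try simp only at h1
    nlinarith

structure Core (x F δ p Δ Q : ℝ → ℝ) (τ a b : ℝ) : Prop where
  hτ : 0 ≤ τ
  ha : 0 < a
  hb : 0 < b
  hd : ∀ t ≥ (0:ℝ), HasDerivWithinAt x (F t - δ t * x t) (Ici 0) t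
  hc : ContinuousOn x (Ici (-τ))
  hi : ∀ θ ∈ Ico (-τ) (0:ℝ), 0 ≤ x θ
  h0 : 0 < x 0
  hδ : ∀ t ≥ (0:ℝ), 0 < δ t
  hp : ∀ t ≥ (0:ℝ), 0 < p t
  hΔ : ∀ t ≥ (0:ℝ), HasDerivAt Δ (δ t) t
  hQ : ∀ t ≥ (0:ℝ), HasDerivAt Q (p t) t
  hinf : Tendsto Δ atTop atTop
  hF : ∀ t ≥ (0:ℝ), ∀ l C : ℝ, 0 ≤ l → (∀ s ∈ Icc (t - τ) t, l ≤ x s ∧ x s ≤ C) →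
    p t * l * Real.exp (-(b * C)) ≤ F t ∧ F t ≤ p t * C * Real.exp (-(a * l))

section
variable {x F δ p Δ Q : ℝ → ℝ} {τ a b : ℝ}

theorem Core.Fnonneg (H : Core x F δ p Δ Q τ a b) {t : ℝ} (ht : 0 ≤ t)
    (h : ∀ s ∈ Icc (t - τ) t, 0 ≤ x s) : 0 ≤ F t := by
  have hcc : ContinuousOn x (Icc (t - τ) t) := H.hc.mono fun u hu => by
    have := hu.1; simp only [mem_Ici]; linarith
  obtain ⟨C, hC⟩ := (isCompact_Icc.image_of_continuousOn hcc).bddAbove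
  have := (H.hF t ht 0 C le_rfl fun s hs => ⟨h s hs, hC (mem_image_of_mem _ hs)⟩).1
  simpa using this

theorem Core.pos (H : Core x F δ p Δ Q τ a b) : ∀ t ≥ (0:ℝ), 0 < x t := by
  have key := aux_cross (fun t => x t - x 0 / 2 * Real.exp (-(2 * (Δ t - Δ 0)))) 0 ?_ ?_ ?_
  · intro t ht
    have h1 := key t ht
    have := mul_pos (half_pos H.h0) (Real.exp_pos (-(2 * (Δ t - Δ 0))))
    try simp only at h1
    linarith
  · intro t ht
    refine (H.hd t ht).continuousWithinAt.sub ?_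
    have : ContinuousAt Δ t := (H.hΔ t ht).continuousAt
    exact (by fun_prop : ContinuousAt (fun t => x 0 / 2 * Real.exp (-(2 * (Δ t - Δ 0)))) t).continuousWithinAt
  · have := H.h0
    simp; linarith
  · intro t ht hall hz
    have hpos := mul_pos (half_pos H.h0) (Real.exp_pos (-(2 * (Δ t - Δ 0))))
    have hxt : 0 < x t := by linarith
    have hFt : 0 ≤ F t := by
      refine H.Fnonneg ht fun s hs => ?_
      rcases lt_or_ge s 0 with h | h
      · exact H.hi s ⟨by have := hs.1; linarith, h⟩
      · have h1 := hall s ⟨h, hs.2⟩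
        have := mul_pos (half_pos H.h0) (Real.exp_pos (-(2 * (Δ s - Δ 0))))
        try simp only at h1
        linarith
    have hder := ((H.hd t ht).mono (Ici_subset_Ici.2 ht)).sub
      (((((H.hΔ t ht).sub_const (Δ 0)).const_mul 2).neg.exp.const_mul (x 0 / 2)).hasDerivWithinAt (s := Ici t))
    refine ⟨_, ?_, hder⟩
    have e : x 0 / 2 * (Real.exp (-(2 * (Δ t - Δ 0))) * -(2 * δ t)) = x t * -(2 * δ t) := by
      try simp only at hz
      have : x t = x 0 / 2 * Real.exp (-(2 * (Δ t - Δ 0))) := by linarith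
      rw [this]; ring
    show 0 < F t - δ t * x t - x 0 / 2 * (Real.exp (-(2 * (Δ t - Δ 0))) * -(2 * δ t))
    rw [e]
    have := mul_pos (H.hδ t ht) hxt
    nlinarith

theorem Core.nonneg (H : Core x F δ p Δ Q τ a b) : ∀ t ≥ -τ, 0 ≤ x t := by
  intro t ht
  rcases lt_or_ge t 0 with h | h
  · exact H.hi t ⟨ht, h⟩
  · exact (H.pos t h).le

theorem Core.monoΔ (H : Core x F δ p Δ Q τ a b) : MonotoneOn Δ (Ici 0) :=
  aux_mono Δ δ 0 le_rfl (fun t ht => (H.hΔ t ht).hasDerivWithinAt) fun t ht => (H.hδ t ht).le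

theorem Core.monoQ (H : Core x F δ p Δ Q τ a b) : MonotoneOn Q (Ici 0) :=
  aux_mono Q p 0 le_rfl (fun t ht => (H.hQ t ht).hasDerivWithinAt) fun t ht => (H.hp t ht).le

/-- decay at most like `exp (-Δ)` -/
theorem Core.decay (H : Core x F δ p Δ Q τ a b) {s t : ℝ} (hs : 0 ≤ s) (hst : s ≤ t) :
    x s ≤ Real.exp (Δ t - Δ s) * x t := by
  have hm := aux_mono (fun t => x t * Real.exp (Δ t)) (fun t => F t * Real.exp (Δ t)) 0 le_rfl
    (fun t ht => by
      have := (H.hd t ht).mul (H.hΔ t ht).exp.hasDerivWithinAt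
      refine this.congr_deriv ?_
      ring)
    (fun t ht => mul_nonneg (H.Fnonneg ht fun u hu => H.nonneg u (by have := hu.1; linarith))
      (Real.exp_pos _).le)
  have := hm (mem_Ici.2 hs) (mem_Ici.2 (hs.trans hst)) hst
  try simp only at this
  rw [Real.exp_sub, div_mul_eq_mul_div, le_div_iff₀ (Real.exp_pos _)]
  linarith

/-- growth -/
theorem Core.growth (H : Core x F δ p Δ Q τ a b) {s t Y : ℝ} (hs : 0 ≤ s) (hst : s ≤ t)
    (hY : ∀ u ∈ Icc (s - τ) s, x u ≤ Y) :
    x t ≤ Y * Real.exp (Q t - Q s) := by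
  have hss : x s ≤ Y := hY s ⟨by linarith [H.hτ], le_rfl⟩
  have hY0 : 0 < Y := (H.pos s hs).trans_le hss
  have key := aux_cross (fun t => Y * Real.exp (Q t - Q s) - x t) s ?_ ?_ ?_ t hst
  · simpa using key
  · intro t ht
    have ht0 := hs.trans ht
    have : ContinuousAt Q t := (H.hQ t ht0).continuousAt
    exact (by fun_prop : ContinuousAt (fun t => Y * Real.exp (Q t - Q s)) t).continuousWithinAt.sub
      ((H.hd t ht0).continuousWithinAt.mono (Ici_subset_Ici.2 hs))
  · simpa using hss
  · intro t ht hall hz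
    have ht0 : 0 ≤ t := hs.trans ht
    refine ⟨_, ?_, (((H.hQ t ht0).sub_const (Q s)).exp.const_mul Y).hasDerivWithinAt.sub
      ((H.hd t ht0).mono (Ici_subset_Ici.2 ht0))⟩
    have hxt : Y * Real.exp (Q t - Q s) = x t := by linarith
    have hF := (H.hF t ht0 0 (x t) le_rfl fun u hu => ⟨H.nonneg u (by linarith [hu.1]), ?_⟩).2
    · have := mul_pos (H.hδ t ht0) (H.pos t ht0)
      simp at hF
      have e : Y * (Real.exp (Q t - Q s) * p t) = p t * x t := by rw [← hxt]; ring
      rw [e]; linarith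
    · rw [← hxt]
      rcases le_or_gt s u with h | h
      · have h1 := hall u ⟨h, hu.2⟩
        have h2 : Q u ≤ Q t := H.monoQ (hs.trans h) ht0 hu.2
        have h3 : Y * Real.exp (Q u - Q s) ≤ Y * Real.exp (Q t - Q s) := by gcongr
        try simp only at h1
        linarith
      · have h1 := hY u ⟨by linarith [hu.1], h.le⟩
        have h2 : Q s ≤ Q t := H.monoQ hs ht0 ht
        have h3 : Y * 1 ≤ Y * Real.exp (Q t - Q s) := by
          gcongr; exact Real.one_le_exp (by linarith)
        linarith

theorem Core.ratio (H : Core x F δ p Δ Q τ a b) {D P T s t : ℝ} (hT : 0 ≤ T)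
    (hD : ∀ t ≥ T, Δ t - Δ (t - τ) ≤ D) (hP : ∀ t ≥ T, Q t - Q (t - τ) ≤ P)
    (hs : T + τ ≤ s) (hst : s ∈ Icc (t - τ) t) :
    x t ≤ Real.exp (D + P) * x s := by
  have hτ := H.hτ
  have hs0 : 0 ≤ s := by linarith
  have h1 := H.growth (s := s) (t := t) (Y := Real.exp D * x s) hs0 hst.2 (fun u hu => by
    refine (H.decay (by linarith [hu.1]) hu.2).trans ?_
    have := H.pos s hs0
    have h2 : Δ (s - τ) ≤ Δ u := H.monoΔ (show 0 ≤ s - τ by linarith) (show 0 ≤ u by linarith [hu.1]) hu.1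
    have := hD s (by linarith)
    gcongr
    linarith)
  refine h1.trans ?_
  have h2 : Q (t - τ) ≤ Q s := H.monoQ (show 0 ≤ t - τ by linarith [hst.2]) hs0 hst.1
  have h3 := hP t (by linarith [hst.2])
  have h4 : Real.exp (Q t - Q s) ≤ Real.exp P := Real.exp_le_exp.2 (by linarith)
  have := mul_le_mul_of_nonneg_left h4 (mul_pos (Real.exp_pos D) (H.pos s hs0)).le
  rw [Real.exp_add]
  linarith

structure Asym (δ p Δ Q : ℝ → ℝ) (τ α γ D P : ℝ) : Prop where
  hD : ∀ D' > D, ∀ᶠ t in atTop, Δ t - Δ (t - τ) ≤ D'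
  hP : ∀ P' > P, ∀ᶠ t in atTop, Q t - Q (t - τ) ≤ P'
  hα : ∀ α' < α, ∀ᶠ t in atTop, α' * δ t ≤ p t
  hγ : ∀ γ' > γ, ∀ᶠ t in atTop, p t ≤ γ' * δ t

variable {α γ D P : ℝ}

theorem exists_small {h : ℝ → ℝ} (hc : Continuous h) (h0 : 0 < h 0) : ∃ ε > 0, ε < 1 ∧ 0 < h ε := by
  have h1 : ∀ᶠ e in 𝓝[>] (0:ℝ), 0 < h e :=
    (hc.continuousAt.eventually (lt_mem_nhds h0)).filter_mono nhdsWithin_le_nhds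
  have h2 : ∀ᶠ e in 𝓝[>] (0:ℝ), e < 1 :=
    (gt_mem_nhds (zero_lt_one)).filter_mono nhdsWithin_le_nhds
  obtain ⟨e, ⟨he1, he2⟩, he3⟩ := ((h1.and h2).and self_mem_nhdsWithin).exists
  exact ⟨e, he3, he2, he1⟩

theorem Core.keyU (H : Core x F δ p Δ Q τ a b) (A : Asym δ p Δ Q τ α γ D P) (hγ : 1 < γ)
    {μ : ℝ} (hμ : 1 / a * Real.log γ * Real.exp (D + P) < μ) :
    ∃ θ c T : ℝ, 0 < θ ∧ θ < 1 ∧ 0 < c ∧ 0 ≤ T ∧ ∀ t ≥ T, ∀ B ≥ μ,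
      (∀ s ∈ Icc (t - τ) t, x s ≤ B) → θ * B ≤ x t → F t - δ t * x t ≤ -(c * B * δ t) := by
  have ha := H.ha
  have hτ := H.hτ
  have hμ0 : 0 < μ := lt_of_le_of_lt (by have := Real.log_pos hγ; positivity) hμ
  obtain ⟨ε, hε0, hε1, hε⟩ := exists_small
    (h := fun ε => (1 - ε) - (γ + ε) * Real.exp (-(a * ((1 - ε) * μ * Real.exp (-((D + ε) + (P + ε)))))))
    (by fun_prop) (by
      have h1 : Real.log γ < a * (μ * Real.exp (-(D + P))) := by
        rw [Real.exp_neg, ← div_eq_mul_inv]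
        rw [mul_div_assoc', lt_div_iff₀ (Real.exp_pos _)]
        have := mul_lt_mul_of_pos_left hμ ha
        calc _ = a * (1 / a * Real.log γ * Real.exp (D + P)) := by field_simp
          _ < _ := this
      have h2 : Real.exp (-(a * (μ * Real.exp (-(D + P))))) < γ⁻¹ := by
        rw [Real.exp_neg]
        refine inv_strictAnti₀ (by linarith) ?_
        rwa [← Real.log_lt_iff_lt_exp (by linarith)]
      have h3 := mul_lt_mul_of_pos_left h2 (show 0 < γ by linarith)
      rw [mul_inv_cancel₀ (by linarith)] at h3
      simpa using h3)
  obtain ⟨T, hT⟩ := ((A.hD (D + ε) (by linarith)).and ((A.hP (P + ε) (by linarith)).and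
    (A.hγ (γ + ε) (by linarith)))).exists_forall_of_atTop
  refine ⟨1 - ε, _, max T 0 + 2 * τ, by linarith, by linarith, hε, by positivity, ?_⟩
  intro t ht B hB hxB hxt
  have hT0 : max T 0 ≤ t := by linarith
  have ht0 : 0 ≤ t := (le_max_right _ _).trans hT0
  have hB0 : 0 < B := by linarith
  set E := Real.exp (-((D + ε) + (P + ε))) with hE
  have hE0 : 0 < E := Real.exp_pos _
  have hlow : ∀ s ∈ Icc (t - τ) t, (1 - ε) * μ * E ≤ x s := by
    intro s hs
    have h1 := H.ratio (D := D + ε) (P := P + ε) (T := max T 0) (s := s) (t := t) (le_max_right _ _)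
      (fun t ht => (hT t ((le_max_left _ _).trans ht)).1)
      (fun t ht => (hT t ((le_max_left _ _).trans ht)).2.1) (by linarith [hs.1]) hs
    have h2 : (1 - ε) * μ ≤ Real.exp ((D + ε) + (P + ε)) * x s :=
      (mul_le_mul_of_nonneg_left hB (by linarith)).trans (hxt.trans h1)
    have h3 := mul_le_mul_of_nonneg_right h2 hE0.le
    have h4 : Real.exp ((D + ε) + (P + ε)) * E = 1 := by rw [hE, ← Real.exp_add, add_neg_cancel, Real.exp_zero]
    calc _ ≤ _ := h3
      _ = (Real.exp ((D + ε) + (P + ε)) * E) * x s := by ring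
      _ = _ := by rw [h4, one_mul]
  have hF := (H.hF t ht0 ((1 - ε) * μ * E) B
    (by have : 0 ≤ 1 - ε := by linarith
        positivity) fun s hs => ⟨hlow s hs, hxB s hs⟩).2
  have hpγ := (hT t ((le_max_left _ _).trans hT0)).2.2
  have hδ := H.hδ t ht0
  set w := Real.exp (-(a * ((1 - ε) * μ * E)))
  have hw : 0 < w := Real.exp_pos _
  have h1 : p t * B * w ≤ (γ + ε) * δ t * B * w := by gcongr
  have h2 := mul_le_mul_of_nonneg_left hxt hδ.le
  show _ ≤ -((1 - ε - (γ + ε) * w) * B * δ t)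
  nlinarith

theorem Core.keyL (H : Core x F δ p Δ Q τ a b) (A : Asym δ p Δ Q τ α γ D P) (hα : 1 < α)
    {μ : ℝ} (hμ0 : 0 < μ) (hμ : μ < 1 / b * Real.log α * Real.exp (-D)) :
    ∃ θ c T : ℝ, 1 < θ ∧ 0 < c ∧ 0 ≤ T ∧ ∀ t ≥ T, ∀ B, 0 < B → B ≤ μ →
      (∀ s ∈ Icc (t - τ) t, B ≤ x s) → x t ≤ θ * B → c * B * δ t ≤ F t - δ t * x t := by
  have hb := H.hb
  have hτ := H.hτ
  obtain ⟨ε, hε0, hε1, hε⟩ := exists_small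
    (h := fun ε => (α - ε) * Real.exp (-(b * (Real.exp (D + ε) * ((1 + ε) * μ)))) - (1 + ε))
    (by fun_prop) (by
      have h1 : b * (Real.exp D * μ) < Real.log α := by
        have := mul_lt_mul_of_pos_left hμ (mul_pos hb (Real.exp_pos D))
        have e : b * Real.exp D * (1 / b * Real.log α * Real.exp (-D)) = Real.log α := by
          rw [Real.exp_neg]; field_simp
        rw [e] at this
        linarith
      have h2 : α⁻¹ < Real.exp (-(b * (Real.exp D * μ))) := by
        rw [Real.exp_neg]
        refine inv_strictAnti₀ (Real.exp_pos _) ?_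
        rwa [← Real.lt_log_iff_exp_lt (by linarith)]
      have h3 := mul_lt_mul_of_pos_left h2 (show 0 < α by linarith)
      rw [mul_inv_cancel₀ (by linarith)] at h3
      simpa using h3)
  obtain ⟨T, hT⟩ := ((A.hD (D + ε) (by linarith)).and
    (A.hα (α - ε) (by linarith))).exists_forall_of_atTop
  refine ⟨1 + ε, _, max T 0 + τ, by linarith, hε, by positivity, ?_⟩
  intro t ht B hB0 hB hxB hxt
  have hT0 : max T 0 ≤ t := by linarith
  have ht0 : 0 ≤ t := (le_max_right _ _).trans hT0
  have htτ : 0 ≤ t - τ := by linarith [le_max_right T 0]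
  have hup : ∀ s ∈ Icc (t - τ) t, x s ≤ Real.exp (D + ε) * ((1 + ε) * μ) := by
    intro s hs
    have hs0 : 0 ≤ s := htτ.trans hs.1
    refine (H.decay hs0 hs.2).trans ?_
    have h1 : Δ (t - τ) ≤ Δ s := H.monoΔ htτ hs0 hs.1
    have h2 := (hT t ((le_max_left _ _).trans hT0)).1
    have h3 : x t ≤ (1 + ε) * μ := hxt.trans (by gcongr)
    have := (H.pos t ht0).le
    gcongr
    linarith
  have hF := (H.hF t ht0 B _ hB0.le fun s hs => ⟨hxB s hs, hup s hs⟩).1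
  have hpα := (hT t ((le_max_left _ _).trans hT0)).2
  have hδ := H.hδ t ht0
  set w := Real.exp (-(b * (Real.exp (D + ε) * ((1 + ε) * μ))))
  have hw : 0 < w := Real.exp_pos _
  have h1 : (α - ε) * δ t * B * w ≤ p t * B * w := by gcongr
  have h2 := mul_le_mul_of_nonneg_left hxt hδ.le
  show ((α - ε) * w - (1 + ε)) * B * δ t ≤ _
  nlinarith

theorem Core.contIcc (H : Core x F δ p Δ Q τ a b) {t : ℝ} (ht : 0 ≤ t) :
    ContinuousOn x (Icc (t - τ) t) := H.hc.mono fun u hu => by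
  have := hu.1; simp only [mem_Ici]; linarith

theorem Core.contIci (H : Core x F δ p Δ Q τ a b) {t : ℝ} (ht : 0 ≤ t) :
    ContinuousOn x (Ici t) := H.hc.mono fun u hu => by
  have : t ≤ u := hu
  have := H.hτ
  simp only [mem_Ici]; linarith

theorem Core.bddAbove (H : Core x F δ p Δ Q τ a b) (A : Asym δ p Δ Q τ α γ D P) (hγ : 1 < γ) :
    ∃ C T : ℝ, 0 ≤ T ∧ ∀ t ≥ T, x t ≤ C := by
  obtain ⟨θ, c, T, hθ0, hθ1, hc, hT, key⟩ := H.keyU A hγ (lt_add_one _)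
  have hM : 0 ≤ 1 / a * Real.log γ * Real.exp (D + P) := by
    have := Real.log_pos hγ
    have := H.ha
    positivity
  obtain ⟨C, hC⟩ := (isCompact_Icc.image_of_continuousOn (H.contIcc hT)).bddAbove
  set B := max C (1 / a * Real.log γ * Real.exp (D + P) + 1) with hB
  have hB1 : 1 / a * Real.log γ * Real.exp (D + P) + 1 ≤ B := le_max_right _ _
  have hB0 : 0 < B := by linarith
  have hhist : ∀ u ∈ Icc (T - τ) T, x u ≤ B := fun u hu => (hC (mem_image_of_mem _ hu)).trans (le_max_left _ _)
  refine ⟨B, T, hT, fun t ht => ?_⟩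
  have := aux_cross (fun t => B - x t) T (continuousOn_const.sub (H.contIci hT))
    (by have := hhist T ⟨by linarith [H.hτ], le_rfl⟩; simpa using this) ?_ t ht
  · simpa using this
  · intro t ht hall hz
    have ht0 := hT.trans ht
    refine ⟨_, ?_, ((H.hd t ht0).mono (Ici_subset_Ici.2 ht0)).const_sub B⟩
    have hz' : x t = B := by linarith
    have h1 := key t ht B hB1 (fun s hs => by
      rcases le_or_gt T s with h | h
      · have := hall s ⟨h, hs.2⟩
        simpa using this
      · exact hhist s ⟨by linarith [hs.1], h.le⟩) (by rw [hz']; nlinarith)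
    have := mul_pos (mul_pos hc hB0) (H.hδ t ht0)
    linarith

theorem Core.bddBelow (H : Core x F δ p Δ Q τ a b) (A : Asym δ p Δ Q τ α γ D P) (hα : 1 < α) :
    ∃ C T : ℝ, 0 < C ∧ 0 ≤ T ∧ ∀ t ≥ T, C ≤ x t := by
  have hm0 : 0 < 1 / b * Real.log α * Real.exp (-D) := by
    have := Real.log_pos hα
    have := H.hb
    positivity
  obtain ⟨θ, c, T', hθ1, hc, hT', key⟩ := H.keyL A hα (half_pos hm0) (half_lt_self hm0)
  set T := T' + τ with hTdef
  have hτ := H.hτ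
  have hT : 0 ≤ T := by linarith
  obtain ⟨u0, hu0, hmin⟩ := isCompact_Icc.exists_isMinOn (nonempty_Icc.2 (by linarith : T - τ ≤ T)) (H.contIcc hT)
  have hxu0 : 0 < x u0 := H.pos u0 (by linarith [hu0.1])
  set B := min (x u0) (1 / b * Real.log α * Real.exp (-D) / 2) with hB
  have hB0 : 0 < B := lt_min hxu0 (half_pos hm0)
  have hhist : ∀ u ∈ Icc (T - τ) T, B ≤ x u := fun u hu => (min_le_left _ _).trans (hmin hu)
  refine ⟨B, T, hB0, hT, fun t ht => ?_⟩
  have := aux_cross (fun t => x t - B) T ((H.contIci hT).sub continuousOn_const)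
    (by have := hhist T ⟨by linarith [H.hτ], le_rfl⟩; simpa using this) ?_ t ht
  · simpa using this
  · intro t ht hall hz
    have ht0 := hT.trans ht
    refine ⟨_, ?_, ((H.hd t ht0).mono (Ici_subset_Ici.2 ht0)).sub_const B⟩
    have hz' : x t = B := by linarith
    have h1 := key t (by linarith) B hB0 (min_le_right _ _) (fun s hs => by
      rcases le_or_gt T s with h | h
      · have := hall s ⟨h, hs.2⟩
        simpa using this
      · exact hhist s ⟨by linarith [hs.1], h.le⟩) (by rw [hz']; nlinarith)
    have := mul_pos (mul_pos hc hB0) (H.hδ t ht0)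
    linarith

theorem Core.isBddLe (H : Core x F δ p Δ Q τ a b) (A : Asym δ p Δ Q τ α γ D P) (hγ : 1 < γ) :
    IsBoundedUnder (· ≤ ·) atTop x := by
  obtain ⟨C, T, _, h⟩ := H.bddAbove A hγ
  exact ⟨C, by simpa using (eventually_ge_atTop T).mono h⟩

theorem Core.isBddGe (H : Core x F δ p Δ Q τ a b) :
    IsBoundedUnder (· ≥ ·) atTop x :=
  ⟨0, by simpa using (eventually_ge_atTop (0:ℝ)).mono fun t ht => (H.pos t ht).le⟩

theorem Core.upper (H : Core x F δ p Δ Q τ a b) (A : Asym δ p Δ Q τ α γ D P) (hγ : 1 < γ) :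
    limsup x atTop ≤ 1 / a * Real.log γ * Real.exp (D + P) := by
  by_contra hlt
  push Not at hlt
  set L := limsup x atTop with hL
  have hM : 0 ≤ 1 / a * Real.log γ * Real.exp (D + P) := by
    have := Real.log_pos hγ
    have := H.ha
    positivity
  have hL0 : 0 < L := by linarith
  obtain ⟨μ, hμ1, hμ2⟩ := exists_between hlt
  obtain ⟨θ, c, T, hθ0, hθ1, hc, hT, key⟩ := H.keyU A hγ hμ1
  obtain ⟨B, hB1, hB2⟩ := exists_between (show L < L / θ by
    rw [lt_div_iff₀ hθ0]; nlinarith)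
  have hB0 : 0 < B := by linarith
  rw [lt_div_iff₀ hθ0] at hB2
  have hev : ∀ᶠ t in atTop, x t < B := eventually_lt_of_limsup_lt hB1 (H.isBddLe A hγ)
  obtain ⟨T1, hT1⟩ := hev.exists_forall_of_atTop
  obtain ⟨T2, hT2, hfin⟩ := aux_descent x _ Δ δ H.hd H.hΔ H.hδ H.hinf 0 (fun t ht => (H.pos t ht).le)
    (θ * B) (c * B) (max T (T1 + τ)) (hT.trans (le_max_left _ _)) (mul_pos hc hB0)
    (fun t ht h => key t ((le_max_left _ _).trans ht) B (by linarith)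
      (fun s hs => (hT1 s (by linarith [hs.1, le_max_right T (T1 + τ)])).le) h)
  have : L ≤ θ * B := limsup_le_of_le H.isBddGe.isCoboundedUnder_le
    ((eventually_ge_atTop T2).mono hfin)
  linarith

theorem Core.lower (H : Core x F δ p Δ Q τ a b) (A : Asym δ p Δ Q τ α γ D P) (hα : 1 < α)
    (hγ : 1 < γ) :
    1 / b * Real.log α * Real.exp (-D) ≤ liminf x atTop := by
  by_contra hlt
  push Not at hlt
  set L := liminf x atTop with hL
  obtain ⟨C, T0, hC, _, hCx⟩ := H.bddBelow A hα
  have hCL : C ≤ L := le_liminf_of_le (H.isBddLe A hγ).isCoboundedUnder_ge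
    ((eventually_ge_atTop T0).mono hCx)
  have hL0 : 0 < L := by linarith
  obtain ⟨μ, hμ1, hμ2⟩ := exists_between hlt
  obtain ⟨θ, c, T, hθ1, hc, hT, key⟩ := H.keyL A hα (by linarith) hμ2
  have hθ0 : 0 < θ := by linarith
  obtain ⟨B, hB1, hB2⟩ := exists_between (show L / θ < L by
    rw [div_lt_iff₀ hθ0]; nlinarith)
  have hB0 : 0 < B := (div_pos hL0 hθ0).trans hB1
  rw [div_lt_iff₀ hθ0] at hB1
  have hev : ∀ᶠ t in atTop, B < x t := eventually_lt_of_lt_liminf hB2 H.isBddGe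
  obtain ⟨T1, hT1⟩ := hev.exists_forall_of_atTop
  obtain ⟨C', T3, hT3, hC'⟩ := H.bddAbove A hγ
  obtain ⟨C'', hC''⟩ := (isCompact_Icc.image_of_continuousOn
    ((H.contIci le_rfl).mono (Icc_subset_Ici_self : Icc 0 T3 ⊆ Ici 0))).bddAbove
  obtain ⟨T2, hT2, hfin⟩ := aux_descent (fun t => -x t) _ Δ δ (fun t ht => (H.hd t ht).neg) H.hΔ H.hδ
    H.hinf (-(max C' C'')) (fun t ht => by
      rcases le_or_gt T3 t with h | h
      · exact neg_le_neg ((hC' t h).trans (le_max_left _ _))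
      · exact neg_le_neg ((hC'' (mem_image_of_mem _ ⟨ht, h.le⟩)).trans (le_max_right _ _)))
    (-(θ * B)) (c * B) (max T (T1 + τ)) (hT.trans (le_max_left _ _)) (mul_pos hc hB0)
    (fun t ht h => neg_le_neg (key t ((le_max_left _ _).trans ht) B hB0 (by linarith)
      (fun s hs => (hT1 s (by linarith [hs.1, le_max_right T (T1 + τ)])).le) (by linarith)))
  have : θ * B ≤ L := le_liminf_of_le (H.isBddLe A hγ).isCoboundedUnder_ge
    ((eventually_ge_atTop T2).mono fun t ht => by have := hfin t ht; linarith)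
  linarith

end
theorem aux_prim (f : ℝ → ℝ) (hf : ContinuousOn f (Ici 0)) :
    ∃ G : ℝ → ℝ, (∀ t ≥ (0:ℝ), HasDerivAt G (f t) t) ∧
      ∀ s t : ℝ, 0 ≤ s → 0 ≤ t → ∫ u in s..t, f u = G t - G s := by
  have hc : Continuous (fun u => f (max u 0)) :=
    hf.comp_continuous (by fun_prop) fun u => mem_Ici.2 (le_max_right _ _)
  refine ⟨fun t => ∫ u in (0:ℝ)..t, f (max u 0), fun t ht => ?_, fun s t hs ht => ?_⟩
  · have := (hc.integral_hasStrictDerivAt 0 t).hasDerivAt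
    simpa [max_eq_left ht] using this
  · rw [intervalIntegral.integral_interval_sub_left (hc.intervalIntegrable _ _) (hc.intervalIntegrable _ _)]
    refine intervalIntegral.integral_congr fun u hu => ?_
    have : 0 ≤ u := (le_min hs ht).trans hu.1
    simp [max_eq_left this]

/-- Under (A0)--(A3), equation (*) is uniformly permanent with the explicit bounds
`m = (1/a⁺)(log α) e^{-(2D+P)}` and `M = (1/a⁻)(log γ) e^{2(D+P)}`. -/
theorem uniform_permanence_with_explicit_bounds
    (m : ℕ) (hm : 0 < m) (p a : Fin m → ℝ → ℝ) (δ : ℝ → ℝ)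
    (τd σd : Fin m → ℝ → ℝ) (τ : ℝ)
    (hA0 : HypA0 m p a δ τd σd) (hτ : IsMaxDelay m τd σd τ)
    (hA1 : HypA1 m p δ) (hA2 : HypA2 m p τ) (hA3 : HypA3 δ)
    (aminus aplus : ℝ)
    (haminus : IsGLB {r : ℝ | ∃ j : Fin m, ∃ t : ℝ, 0 ≤ t ∧ r = a j t} aminus)
    (haplus : IsLUB {r : ℝ | ∃ j : Fin m, ∃ t : ℝ, 0 ≤ t ∧ r = a j t} aplus)
    (α γ D P : ℝ)
    (hα : α = Filter.liminf (fun t => (∑ j, p j t) / δ t) Filter.atTop)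
    (hγ : γ = Filter.limsup (fun t => (∑ j, p j t) / δ t) Filter.atTop)
    (hD : D = Filter.limsup (fun t => ∫ s in t - τ..t, δ s) Filter.atTop)
    (hP : P = Filter.limsup (fun t => ∫ s in t - τ..t, (∑ j, p j s)) Filter.atTop)
    (x : ℝ → ℝ) (hx : IsPosSol m p a δ τd σd τ x) :
    (1 / aplus) * Real.log α * Real.exp (-(2 * D + P)) ≤ Filter.liminf x Filter.atTop ∧
      Filter.liminf x Filter.atTop ≤ Filter.limsup x Filter.atTop ∧
      Filter.limsup x Filter.atTop ≤ (1 / aminus) * Real.log γ * Real.exp (2 * (D + P)) := by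
  
  obtain ⟨hp0, ha0, ⟨hδc, hδ0⟩, hdel⟩ := hA0
  obtain ⟨hxc, hxi, hx0, hxd⟩ := hx
  have hj0 : Fin m := ⟨0, hm⟩
  have hle : ∀ j, ∀ t ≥ (0:ℝ), τd j t ≤ τ ∧ σd j t ≤ τ := fun j t ht =>
    ⟨hτ.1 ⟨j, t, ht, Or.inl rfl⟩, hτ.1 ⟨j, t, ht, Or.inr rfl⟩⟩
  have hτ0 : 0 ≤ τ := (((hdel hj0).2.2.1 0 le_rfl).1).trans (hle hj0 0 le_rfl).1
  have ham : ∀ j, ∀ t ≥ (0:ℝ), aminus ≤ a j t := fun j t ht => haminus.1 ⟨j, t, ht, rfl⟩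
  have hap : ∀ j, ∀ t ≥ (0:ℝ), a j t ≤ aplus := fun j t ht => haplus.1 ⟨j, t, ht, rfl⟩
  have ham0 : 0 < aminus := by
    choose _ c C hc hcC using ha0
    have hne : (Finset.univ : Finset (Fin m)).Nonempty := ⟨hj0, Finset.mem_univ _⟩
    obtain ⟨k, _, hk⟩ := Finset.exists_min_image Finset.univ c hne
    refine (hc k).trans_le (haminus.2 ?_)
    rintro r ⟨j, t, ht, rfl⟩
    exact (hk j (Finset.mem_univ _)).trans (hcC j t ht).1
  have hap0 : 0 < aplus := ham0.trans_le ((ham hj0 0 le_rfl).trans (hap hj0 0 le_rfl))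
  have hpc : ContinuousOn (fun t => ∑ j, p j t) (Ici 0) :=
    continuousOn_finsetSum _ fun j _ => (hp0 j).1
  have hppos : ∀ t ≥ (0:ℝ), 0 < ∑ j, p j t := fun t ht =>
    Finset.sum_pos (fun j _ => (hp0 j).2 t ht) ⟨hj0, Finset.mem_univ _⟩
  obtain ⟨Δ, hΔ, hΔi⟩ := aux_prim δ hδc
  obtain ⟨Q, hQ, hQi⟩ := aux_prim _ hpc
  have H : Core x (fun t => ∑ j, p j t * x (t - τd j t) * Real.exp (-(a j t * x (t - σd j t))))
      δ (fun t => ∑ j, p j t) Δ Q τ aminus aplus := by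
    refine ⟨hτ0, ham0, hap0, hxd, hxc, hxi, hx0, hδ0, hppos, hΔ, hQ, ?_, ?_⟩
    · have h1 : Tendsto (fun t => (∫ s in (0:ℝ)..t, δ s) + Δ 0) atTop atTop :=
        tendsto_atTop_add_const_right _ _ hA3
      refine h1.congr' ?_
      filter_upwards [eventually_ge_atTop (0:ℝ)] with t ht
      rw [hΔi 0 t le_rfl ht]; ring
    · intro t ht l C hl h
      have hτm : ∀ j, t - τd j t ∈ Icc (t - τ) t := fun j =>
        ⟨by linarith [(hle j t ht).1], by linarith [((hdel j).2.2.1 t ht).1]⟩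
      have hσm : ∀ j, t - σd j t ∈ Icc (t - τ) t := fun j =>
        ⟨by linarith [(hle j t ht).2], by linarith [((hdel j).2.2.1 t ht).2]⟩
      simp only [Finset.sum_mul]
      constructor
      · refine Finset.sum_le_sum fun j _ => ?_
        have h1 := h _ (hτm j)
        have h2 := h _ (hσm j)
        have hpj := (hp0 j).2 t ht
        have h3 := hap j t ht
        have h5 : 0 ≤ x (t - τd j t) := hl.trans h1.1
        have h4 : a j t * x (t - σd j t) ≤ aplus * C :=
          mul_le_mul h3 h2.2 (hl.trans h2.1) hap0.le
        gcongr
        exact h1.1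
      · refine Finset.sum_le_sum fun j _ => ?_
        have h1 := h _ (hτm j)
        have h2 := h _ (hσm j)
        have hpj := (hp0 j).2 t ht
        have h3 := ham j t ht
        have h5 : 0 ≤ C := hl.trans (h1.1.trans h1.2)
        have h4 : aminus * l ≤ a j t * x (t - σd j t) :=
          mul_le_mul h3 h2.1 hl (ham0.le.trans h3)
        gcongr
        exact h1.2
  obtain ⟨hA1a, hA1b⟩ := hA1
  have hbge : IsBoundedUnder (· ≥ ·) atTop (fun t => (∑ j, p j t) / δ t) :=
    ⟨0, by simpa using (eventually_ge_atTop (0:ℝ)).mono fun t ht =>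
      (div_pos (hppos t ht) (hδ0 t ht)).le⟩
  have hα1 : 1 < α := hα ▸ hA1a
  have hγ1 : 1 < γ := by
    refine hα1.trans_le ?_
    rw [hα, hγ]; exact liminf_le_limsup hA1b hbge
  have hδp : ∀ᶠ t in atTop, δ t ≤ ∑ j, p j t := by
    filter_upwards [eventually_lt_of_lt_liminf hA1a hbge, eventually_ge_atTop (0:ℝ)] with t h ht
    rw [lt_div_iff₀ (hδ0 t ht)] at h
    linarith
  have hIΔ : ∀ t ≥ τ, ∫ s in t - τ..t, δ s = Δ t - Δ (t - τ) := fun t ht =>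
    hΔi _ _ (by linarith) (by linarith)
  have hIQ : ∀ t ≥ τ, ∫ s in t - τ..t, (∑ j, p j s) = Q t - Q (t - τ) := fun t ht =>
    hQi _ _ (by linarith) (by linarith)
  have hΔ0 : ∀ t ≥ τ, 0 ≤ ∫ s in t - τ..t, δ s := fun t ht => by
    rw [hIΔ t ht]
    exact sub_nonneg.2 (H.monoΔ (show 0 ≤ t - τ by linarith) (show 0 ≤ t by linarith) (by linarith))
  have hQ0 : ∀ t ≥ τ, 0 ≤ ∫ s in t - τ..t, (∑ j, p j s) := fun t ht => by
    rw [hIQ t ht]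
    exact sub_nonneg.2 (H.monoQ (show 0 ≤ t - τ by linarith) (show 0 ≤ t by linarith) (by linarith))
  have hbD : IsBoundedUnder (· ≤ ·) atTop (fun t => ∫ s in t - τ..t, δ s) := by
    refine IsBoundedUnder.mono_le hA2 ?_
    obtain ⟨T, hT⟩ := hδp.exists_forall_of_atTop
    filter_upwards [eventually_ge_atTop (max T 0 + τ)] with t ht
    have e1 := le_max_left T 0
    have e2 := le_max_right T 0
    have hsub : uIcc (t - τ) t ⊆ Ici 0 := by
      rw [uIcc_of_le (by linarith)]
      intro u hu
      exact (by linarith [hu.1] : 0 ≤ u)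
    refine intervalIntegral.integral_mono_on (by linarith) (hδc.mono hsub).intervalIntegrable
      (hpc.mono hsub).intervalIntegrable fun u hu => hT u (by linarith [hu.1])
  have A : Asym δ (fun t => ∑ j, p j t) Δ Q τ α γ D P := by
    refine ⟨fun D' h => ?_, fun P' h => ?_, fun α' h => ?_, fun γ' h => ?_⟩
    · rw [hD] at h
      filter_upwards [eventually_lt_of_limsup_lt h hbD, eventually_ge_atTop τ] with t h1 h2
      rw [hIΔ t h2] at h1; exact h1.le
    · rw [hP] at h
      filter_upwards [eventually_lt_of_limsup_lt h hA2, eventually_ge_atTop τ] with t h1 h2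
      rw [hIQ t h2] at h1; exact h1.le
    · rw [hα] at h
      filter_upwards [eventually_lt_of_lt_liminf h hbge, eventually_ge_atTop (0:ℝ)] with t h1 h2
      rw [lt_div_iff₀ (hδ0 t h2)] at h1; exact h1.le
    · rw [hγ] at h
      filter_upwards [eventually_lt_of_limsup_lt h hA1b, eventually_ge_atTop (0:ℝ)] with t h1 h2
      rw [div_lt_iff₀ (hδ0 t h2)] at h1; exact h1.le
  have hD0 : 0 ≤ D := by
    rw [hD]
    exact le_limsup_of_frequently_le ((eventually_ge_atTop τ).mono hΔ0).frequently hbD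
  have hP0 : 0 ≤ P := by
    rw [hP]
    exact le_limsup_of_frequently_le ((eventually_ge_atTop τ).mono hQ0).frequently hA2
  have hlα := Real.log_pos hα1
  have hlγ := Real.log_pos hγ1
  refine ⟨le_trans ?_ (H.lower A hα1 hγ1), liminf_le_limsup (H.isBddLe A hγ1) H.isBddGe,
    (H.upper A hγ1).trans ?_⟩
  · have : Real.exp (-(2 * D + P)) ≤ Real.exp (-D) := Real.exp_le_exp.2 (by linarith)
    gcongr
  · have : Real.exp (D + P) ≤ Real.exp (2 * (D + P)) := Real.exp_le_exp.2 (by linarith)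
    gcongr
end
end

section
/- Assume (A0), (A1), (A2), (A3), (K1) and (K2): a⁺K(e^{ζ⁺} − 1) ≤ 1, where ζ⁺ = max_{1≤j≤m} limsup_{t→∞} ∫_{t−σ_j(t)}^t δ(s) ds. Then the positive equilibrium K of equation (*) is globally attractive: every positive solution x of (*) satisfies lim_{t→∞} x(t) = K. -/
open Real Filter MeasureTheory Set

noncomputable section

lemma nich_mono {f f' : ℝ → ℝ} {a b : ℝ} (hab : a ≤ b) (hc : ContinuousOn f (Icc a b))
    (hd : ∀ t ∈ Ioo a b, HasDerivAt f (f' t) t) (h0 : ∀ t ∈ Ioo a b, 0 ≤ f' t) : f a ≤ f b := by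
  have : MonotoneOn f (Icc a b) := by
    apply monotoneOn_of_deriv_nonneg (convex_Icc a b) hc
    · intro t ht
      rw [interior_Icc] at ht
      exact (hd t ht).differentiableAt.differentiableWithinAt
    · intro t ht
      rw [interior_Icc] at ht
      rw [(hd t ht).deriv]
      exact h0 t ht
  exact this (left_mem_Icc.2 hab) (right_mem_Icc.2 hab) hab

lemma nich_anti {f f' : ℝ → ℝ} {a b : ℝ} (hab : a ≤ b) (hc : ContinuousOn f (Icc a b))
    (hd : ∀ t ∈ Ioo a b, HasDerivAt f (f' t) t) (h0 : ∀ t ∈ Ioo a b, f' t ≤ 0) : f b ≤ f a := by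
  have := nich_mono (f := fun t => - f t) (f' := fun t => - f' t) hab hc.neg
    (fun t ht => (hd t ht).neg) (fun t ht => by have := h0 t ht; linarith)
  linarith

lemma nich_first {f : ℝ → ℝ} {a b : ℝ} (hab : a ≤ b) (hc : ContinuousOn f (Icc a b))
    (ha : f a < 0)
    (hs : ∀ s, a < s → s ≤ b → (∀ r, a ≤ r → r < s → f r < 0) → f s = 0 → False) :
    f b < 0 := by
  by_contra hb
  push Not at hb
  have hcl : IsClosed (Icc a b ∩ f ⁻¹' Ici 0) := hc.preimage_isClosed_of_isClosed isClosed_Icc isClosed_Ici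
  have hcpt : IsCompact (Icc a b ∩ f ⁻¹' Ici 0) :=
    isCompact_Icc.of_isClosed_subset hcl inter_subset_left
  obtain ⟨s, ⟨⟨hs1, hs2⟩, hs3⟩, hmin⟩ := hcpt.exists_isLeast ⟨b, ⟨hab, le_rfl⟩, hb⟩
  have hs3 : 0 ≤ f s := hs3
  have hlt : ∀ r, a ≤ r → r < s → f r < 0 := by
    intro r h1 h2
    by_contra h
    push Not at h
    have := hmin ⟨⟨h1, by linarith⟩, h⟩
    linarith
  have has : a < s := by
    rcases eq_or_lt_of_le hs1 with h | h
    · subst h; linarith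
    · exact h
  refine hs s has hs2 hlt (le_antisymm ?_ hs3)
  have hcs : ContinuousWithinAt f (Ico a s) s :=
    (hc s ⟨hs1, hs2⟩).mono (fun r hr => ⟨hr.1, by linarith [hr.2]⟩)
  have hne : (nhdsWithin s (Ico a s)).NeBot := by
    rw [← mem_closure_iff_nhdsWithin_neBot, closure_Ico has.ne]
    exact ⟨hs1, le_rfl⟩
  exact le_of_tendsto hcs (by
    filter_upwards [self_mem_nhdsWithin] with r hr
    exact (hlt r hr.1 hr.2).le)

lemma nich_deriv_nonneg {f : ℝ → ℝ} {f' a t : ℝ} (hat : a < t) (hd : HasDerivAt f f' t)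
    (h : ∀ s, a ≤ s → s < t → f s ≤ f t) : 0 ≤ f' := by
  have h1 := (hasDerivAt_iff_tendsto_slope_left_right.1 hd).1
  refine ge_of_tendsto h1 ?_
  filter_upwards [Ico_mem_nhdsLT hat] with s hs
  rw [slope_def_field]
  have := h s hs.1 hs.2
  have := hs.2
  exact div_nonneg_of_nonpos (by linarith) (by linarith)

lemma nich_exp {A : ℝ} (hA : 0 < A) : 0 < Real.exp A * (A - 2) + A + 2 := by
  have h1 : ∀ t, 0 < t → 0 < Real.exp t * (t - 1) + 1 := by
    intro t ht
    have := Real.add_one_lt_exp (x := -t) (by linarith)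
    have h2 : Real.exp t * Real.exp (-t) = 1 := by rw [← Real.exp_add]; simp
    nlinarith [Real.exp_pos t]
  have hm : StrictMonoOn (fun t : ℝ => Real.exp t * (t - 2) + t + 2) (Icc 0 A) := by
    apply strictMonoOn_of_deriv_pos (convex_Icc 0 A)
    · fun_prop
    · intro t ht
      rw [interior_Icc] at ht
      have hd : HasDerivAt (fun t : ℝ => Real.exp t * (t - 2) + t + 2)
          (Real.exp t * (t - 2) + Real.exp t * 1 + 1) t :=
        ((((Real.hasDerivAt_exp t).mul ((hasDerivAt_id t).sub_const 2)).add
          (hasDerivAt_id t)).add_const 2)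
      rw [hd.deriv]
      have := h1 t ht.1
      linarith
  have := hm (left_mem_Icc.2 hA.le) (right_mem_Icc.2 hA.le) hA
  simpa using this

lemma nich_coth {A : ℝ} (hA : 0 < A) : 1 / A - 1 / 2 < 1 / (Real.exp A - 1) := by
  have h := nich_exp hA
  have h1 : 0 < Real.exp A - 1 := by linarith [Real.add_one_lt_exp hA.ne']
  rw [div_sub_div _ _ hA.ne' two_ne_zero, div_lt_div_iff₀ (by positivity) h1]
  nlinarith

/-- The algebraic core: no nontrivial two-cycle. -/
lemma nich_alg {A B k : ℝ} (hA : 0 < A) (hB : 0 < B) (hk : 0 ≤ k) (hkB : k * B < 1)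
    (h1 : A ≤ (1 + k * A) * (Real.exp B - 1))
    (h2 : B ≤ (1 - k * B) * (1 - Real.exp (-A))) : False := by
  have cA := nich_coth hA
  have cB := nich_coth hB
  have eA : 0 < Real.exp A - 1 := by linarith [Real.add_one_lt_exp hA.ne']
  have eB : 0 < Real.exp B - 1 := by linarith [Real.add_one_lt_exp hB.ne']
  have i1 : 1 / (Real.exp B - 1) ≤ 1 / A + k := by
    rw [div_add' _ _ _ hA.ne', div_le_div_iff₀ eB hA]
    linarith
  have i2 : 1 / (Real.exp A - 1) + 1 ≤ 1 / B - k := by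
    rw [Real.exp_neg] at h2
    have h3 : B * Real.exp A ≤ (1 - k * B) * (Real.exp A - 1) := by
      have := mul_le_mul_of_nonneg_right h2 (Real.exp_pos A).le
      have e : (1 - k * B) * (1 - (Real.exp A)⁻¹) * Real.exp A = (1 - k * B) * (Real.exp A - 1) := by
        field_simp
      linarith
    rw [div_add' _ _ _ eA.ne', div_sub' hB.ne', div_le_div_iff₀ eA hB]
    nlinarith
  linarith

/-- Abstract oscillation lemma. -/
lemma nich_osc {m : ℕ} {δ D y y' : ℝ → ℝ} {σd : Fin m → ℝ → ℝ} {τ B B' k c Z : ℝ}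
    (hσ : ∀ j t, 0 ≤ t → 0 ≤ σd j t ∧ σd j t ≤ τ)
    (hδ : ∀ t, 0 ≤ t → 0 < δ t)
    (hD : ∀ t, 0 < t → HasDerivAt D (δ t) t) (hDtop : Tendsto D atTop atTop)
    (hy : ∀ t, 0 < t → HasDerivAt y (y' t) t)
    (h1 : ∀ᶠ t in atTop, y' t ≤ δ t * (B - y t))
    (h2 : ∀ᶠ t in atTop, (∀ j, k ≤ y (t - σd j t)) → y' t ≤ δ t * (B' - y t))
    (hZ : ∀ᶠ t in atTop, ∀ j, D t - D (t - σd j t) ≤ Z)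
    (hf : ∃ᶠ t in atTop, c < y t) (hB' : B' < c) (hkB : k ≤ B) :
    c ≤ B + (k - B) * Real.exp (-Z) := by
  obtain ⟨T1, hT1⟩ := eventually_atTop.1 h1
  have key : ∃ᶠ t in atTop, c < y t ∧ ∃ j, y (t - σd j t) < k := by
    by_contra hcon
    rw [not_frequently] at hcon
    obtain ⟨T, hT⟩ := eventually_atTop.1 ((h2.and hcon).and (eventually_gt_atTop 0))
    have hT0 : 0 < T := (hT T le_rfl).2
    have hder : ∀ t, T ≤ t → c < y t → y' t ≤ δ t * (B' - c) := by
      intro t ht hc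
      obtain ⟨⟨ha, hb⟩, h0⟩ := hT t ht
      have : ∀ j, k ≤ y (t - σd j t) := by
        intro j
        by_contra hj
        push Not at hj
        exact hb ⟨hc, j, hj⟩
      refine (ha this).trans ?_
      exact mul_le_mul_of_nonneg_left (by linarith) (hδ t h0.le).le
    have hlow : ∃ t1, T ≤ t1 ∧ y t1 ≤ c := by
      by_contra hno
      push Not at hno
      have hanti : ∀ t, T ≤ t → y t + (c - B') * D t ≤ y T + (c - B') * D T := by
        intro t ht
        refine nich_anti (f := fun t => y t + (c - B') * D t)
          (f' := fun t => y' t + (c - B') * δ t) ht ?_ ?_ ?_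
        · intro s hs
          have hs0 : 0 < s := by linarith [hs.1]
          exact ((hy s hs0).add ((hD s hs0).const_mul _)).continuousAt.continuousWithinAt
        · intro s hs
          have hs0 : 0 < s := by linarith [hs.1]
          exact (hy s hs0).add ((hD s hs0).const_mul _)
        · intro s hs
          have := hder s hs.1.le (hno s hs.1.le)
          nlinarith
      obtain ⟨t, ht, ht'⟩ := ((hDtop.eventually_gt_atTop
        ((y T + (c - B') * D T - c) / (c - B'))).and (eventually_ge_atTop T)).exists
      have := hanti t ht'
      have h3 := hno t ht'
      rw [div_lt_iff₀ (by linarith)] at ht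
      nlinarith
    obtain ⟨t1, ht1, hyt1⟩ := hlow
    obtain ⟨t2, hct2, ht2⟩ := (hf.and_eventually (eventually_ge_atTop t1)).exists
    -- last time at which y ≤ c
    have hcont : ContinuousOn y (Icc t1 t2) := fun s hs =>
      (hy s (by linarith [hs.1])).continuousAt.continuousWithinAt
    have hcl : IsClosed (Icc t1 t2 ∩ y ⁻¹' Iic c) :=
      hcont.preimage_isClosed_of_isClosed isClosed_Icc isClosed_Iic
    have hcpt : IsCompact (Icc t1 t2 ∩ y ⁻¹' Iic c) :=
      isCompact_Icc.of_isClosed_subset hcl inter_subset_left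
    obtain ⟨s, ⟨⟨hs1, hs2⟩, hs3⟩, hmax⟩ := hcpt.exists_isGreatest ⟨t1, ⟨le_rfl, ht2⟩, hyt1⟩
    have hs3 : y s ≤ c := hs3
    have hgt : ∀ r, s < r → r ≤ t2 → c < y r := by
      intro r hr1 hr2
      by_contra h
      push Not at h
      have := hmax ⟨⟨by linarith, hr2⟩, h⟩
      linarith
    have : y t2 ≤ y s := by
      refine nich_anti (f' := y') hs2 (hcont.mono (Icc_subset_Icc_left hs1)) ?_ ?_
      · intro r hr
        exact hy r (by linarith [hr.1])
      · intro r hr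
        have h4 := hder r (by linarith [hr.1]) (hgt r hr.1 hr.2.le)
        have := hδ r (by linarith [hr.1])
        nlinarith
    linarith
  obtain ⟨t, ⟨hct, j, hj⟩, hZt, ht⟩ :=
    (key.and_eventually (hZ.and (eventually_ge_atTop (max T1 0 + 1 + τ)))).exists
  have hτ0 : 0 ≤ τ := by
    have := hσ j 0 le_rfl
    linarith
  have hm1 := le_max_left T1 0
  have hm2 := le_max_right T1 0
  have ht0 : 0 ≤ t := by linarith
  obtain ⟨hσ0, hσ1⟩ := hσ j t ht0
  set s := t - σd j t with hs
  have hsT : max T1 0 + 1 ≤ s := by linarith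
  have hv : (y t - B) * Real.exp (D t) ≤ (y s - B) * Real.exp (D s) := by
    have hdd : ∀ r, s ≤ r → HasDerivAt (fun r => (y r - B) * Real.exp (D r))
        (y' r * Real.exp (D r) + (y r - B) * (Real.exp (D r) * δ r)) r := by
      intro r hr
      have hr0 : 0 < r := by linarith
      exact ((hy r hr0).sub_const B).mul ((hD r hr0).exp)
    refine nich_anti (f := fun r => (y r - B) * Real.exp (D r)) (by linarith)
      (fun r hr => (hdd r hr.1).continuousAt.continuousWithinAt) (fun r hr => hdd r hr.1.le) ?_
    intro r hr
    have h5 := hT1 r (by linarith [hr.1])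
    have : y' r * Real.exp (D r) + (y r - B) * (Real.exp (D r) * δ r)
      = (y' r - δ r * (B - y r)) * Real.exp (D r) := by ring
    rw [this]
    exact mul_nonpos_of_nonpos_of_nonneg (by linarith) (Real.exp_pos _).le
  have hv2 : y t - B ≤ (y s - B) * Real.exp (-(D t - D s)) := by
    have e : (y s - B) * Real.exp (-(D t - D s)) * Real.exp (D t) = (y s - B) * Real.exp (D s) := by
      rw [mul_assoc, ← Real.exp_add]; congr 2; ring
    exact le_of_mul_le_mul_right (by rw [e]; exact hv) (Real.exp_pos (D t))
  have hv3 : (y s - B) * Real.exp (-(D t - D s)) ≤ (k - B) * Real.exp (-(D t - D s)) :=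
    mul_le_mul_of_nonneg_right (by linarith) (Real.exp_pos _).le
  have hv4 : (k - B) * Real.exp (-(D t - D s)) ≤ (k - B) * Real.exp (-Z) :=
    mul_le_mul_of_nonpos_left (Real.exp_le_exp.2 (by linarith [hZt j])) (by linarith)
  linarith

/-- Working context. -/
structure NichSetup (m : ℕ) (p a : Fin m → ℝ → ℝ) (δ : ℝ → ℝ) (τd σd : Fin m → ℝ → ℝ)
    (τ K al ap P T0 : ℝ) (D Q x : ℝ → ℝ) : Prop where
  p_pos : ∀ j t, 0 ≤ t → 0 < p j t
  al_pos : 0 < al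
  ap_pos : 0 < ap
  a_bd : ∀ j t, 0 ≤ t → al ≤ a j t ∧ a j t ≤ ap
  δ_pos : ∀ t, 0 ≤ t → 0 < δ t
  τ_nonneg : 0 ≤ τ
  τd_bd : ∀ j t, 0 ≤ t → 0 ≤ τd j t ∧ τd j t ≤ τ
  σd_bd : ∀ j t, 0 ≤ t → 0 ≤ σd j t ∧ σd j t ≤ τ
  K_pos : 0 < K
  K1 : ∀ t, 0 ≤ t → δ t = ∑ j, p j t * Real.exp (-(a j t * K))
  D_cont : ContinuousOn D (Ici 0)
  D_deriv : ∀ t, 0 < t → HasDerivAt D (δ t) t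
  D_top : Tendsto D atTop atTop
  Q_cont : ContinuousOn Q (Ici 0)
  Q_deriv : ∀ t, 0 < t → HasDerivAt Q (∑ j, p j t) t
  T0_ge : τ ≤ T0
  Q_bd : ∀ t, T0 ≤ t → Q t - Q (t - τ) ≤ P
  x_cont : ContinuousOn x (Ici (-τ))
  x_history : ∀ θ, -τ ≤ θ → θ < 0 → 0 ≤ x θ
  x_zero : 0 < x 0
  x_deriv : ∀ t, 0 < t → HasDerivAt x
      ((∑ j, p j t * x (t - τd j t) * Real.exp (-(a j t * x (t - σd j t)))) - δ t * x t) t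

namespace NichSetup

variable {m : ℕ} {p a : Fin m → ℝ → ℝ} {δ : ℝ → ℝ} {τd σd : Fin m → ℝ → ℝ}
    {τ K al ap P T0 : ℝ} {D Q x : ℝ → ℝ}

lemma x_cont0 (S : NichSetup m p a δ τd σd τ K al ap P T0 D Q x) : ContinuousOn x (Ici 0) :=
  S.x_cont.mono (Ici_subset_Ici.2 (by linarith [S.τ_nonneg]))

lemma Q_mono (S : NichSetup m p a δ τd σd τ K al ap P T0 D Q x) {s t : ℝ} (hs : 0 ≤ s)
    (hst : s ≤ t) : Q s ≤ Q t := by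
  refine nich_mono hst (S.Q_cont.mono fun r hr => hs.trans hr.1)
    (fun r hr => S.Q_deriv r (lt_of_le_of_lt hs hr.1)) ?_
  intro r hr
  exact Finset.sum_nonneg fun j _ => (S.p_pos j r (by linarith [hr.1])).le

lemma D_mono (S : NichSetup m p a δ τd σd τ K al ap P T0 D Q x) {s t : ℝ} (hs : 0 ≤ s)
    (hst : s ≤ t) : D s ≤ D t := by
  refine nich_mono hst (S.D_cont.mono fun r hr => hs.trans hr.1)
    (fun r hr => S.D_deriv r (lt_of_le_of_lt hs hr.1)) ?_
  intro r hr
  exact (S.δ_pos r (by linarith [hr.1])).le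

lemma δ_le (S : NichSetup m p a δ τd σd τ K al ap P T0 D Q x) {t : ℝ} (ht : 0 ≤ t) :
    δ t ≤ ∑ j, p j t := by
  rw [S.K1 t ht]
  refine Finset.sum_le_sum fun j _ => ?_
  have h1 := S.p_pos j t ht
  have h2 : Real.exp (-(a j t * K)) ≤ 1 := by
    rw [Real.exp_le_one_iff]
    have := mul_pos (S.al_pos.trans_le (S.a_bd j t ht).1) S.K_pos
    linarith
  nlinarith

lemma D_le_Q (S : NichSetup m p a δ τd σd τ K al ap P T0 D Q x) {s t : ℝ} (hs : 0 ≤ s)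
    (hst : s ≤ t) : D t - D s ≤ Q t - Q s := by
  have := nich_mono (f := fun r => Q r - D r) (f' := fun r => (∑ j, p j r) - δ r) hst
    ((S.Q_cont.sub S.D_cont).mono fun r hr => hs.trans hr.1)
    (fun r hr => (S.Q_deriv r (lt_of_le_of_lt hs hr.1)).sub (S.D_deriv r (lt_of_le_of_lt hs hr.1)))
    (fun r hr => by
      have := S.δ_le (t := r) (by linarith [hr.1])
      linarith)
  linarith

/-- bound for the Q-length of a short interval -/
lemma Q_short (S : NichSetup m p a δ τd σd τ K al ap P T0 D Q x) {s t : ℝ} (ht : T0 ≤ t)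
    (hs : t - τ ≤ s) : Q t - Q s ≤ P := by
  have h1 := S.Q_bd t ht
  have h2 := S.Q_mono (s := t - τ) (t := s) (by linarith [S.T0_ge]) hs
  linarith

lemma x_exp (S : NichSetup m p a δ τd σd τ K al ap P T0 D Q x) {s t : ℝ} (hs : 0 ≤ s)
    (hst : s ≤ t) (hx : ∀ r, -τ ≤ r → r < t → 0 ≤ x r) :
    x s * Real.exp (D s) ≤ x t * Real.exp (D t) := by
  refine nich_mono (f := fun r => x r * Real.exp (D r)) hst
    ((S.x_cont0.mul S.D_cont.rexp).mono fun r hr => hs.trans hr.1)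
    (fun r hr => (S.x_deriv r (lt_of_le_of_lt hs hr.1)).mul
      (S.D_deriv r (lt_of_le_of_lt hs hr.1)).exp) ?_
  intro r hr
  have hr0 : 0 ≤ r := by linarith [hr.1]
  have : 0 ≤ ∑ j, p j r * x (r - τd j r) * Real.exp (-(a j r * x (r - σd j r))) := by
    refine Finset.sum_nonneg fun j _ => ?_
    have h1 := S.p_pos j r hr0
    obtain ⟨h2, h3⟩ := S.τd_bd j r hr0
    have h4 := hx (r - τd j r) (by linarith) (by linarith [hr.2])
    positivity
  have h2 := mul_nonneg this (Real.exp_pos (D r)).le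
  linarith

lemma x_pos (S : NichSetup m p a δ τd σd τ K al ap P T0 D Q x) {t : ℝ} (ht : 0 ≤ t) :
    0 < x t := by
  have := nich_first (f := fun r => - x r) ht (S.x_cont0.neg.mono fun r hr => hr.1)
    (by simpa using S.x_zero) (by
      intro s hs0 hst hlt hs
      have h1 := S.x_exp (s := 0) (t := s) le_rfl hs0.le (by
        intro r hr1 hr2
        rcases lt_or_ge r 0 with h | h
        · exact S.x_history r hr1 h
        · have := hlt r h hr2
          linarith)
      have h2 : x s = 0 := by linarith
      rw [h2, zero_mul] at h1
      have := mul_pos S.x_zero (Real.exp_pos (D 0))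
      linarith)
  linarith

lemma x_nonneg (S : NichSetup m p a δ τd σd τ K al ap P T0 D Q x) {t : ℝ} (ht : -τ ≤ t) :
    0 ≤ x t := by
  rcases lt_or_ge t 0 with h | h
  · exact S.x_history t ht h
  · exact (S.x_pos h).le

/-- backward bound -/
lemma x_back (S : NichSetup m p a δ τd σd τ K al ap P T0 D Q x) {s t : ℝ} (ht : T0 ≤ t)
    (hs : t - τ ≤ s) (hst : s ≤ t) : x s ≤ x t * Real.exp P := by
  have hs0 : 0 ≤ s := by linarith [S.T0_ge]
  have h1 := S.x_exp hs0 hst (fun r hr _ => S.x_nonneg hr)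
  have h2 := S.D_le_Q hs0 hst
  have h3 := S.Q_short ht hs
  have h4 : x t * Real.exp (D t) ≤ x t * Real.exp P * Real.exp (D s) := by
    rw [mul_assoc, ← Real.exp_add]
    exact mul_le_mul_of_nonneg_left (Real.exp_le_exp.2 (by linarith)) (S.x_pos (by linarith)).le
  exact le_of_mul_le_mul_right (h1.trans h4) (Real.exp_pos _)

lemma x_lower (S : NichSetup m p a δ τd σd τ K al ap P T0 D Q x) :
    ∃ lo, 0 < lo ∧ ∀ t, 0 ≤ t → lo ≤ x t := by
  have hT := S.T0_ge
  have hτ := S.τ_nonneg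
  set T1 := T0 + τ + 1 with hT1
  obtain ⟨q, hq, hqmin⟩ := (isCompact_Icc (a := (0:ℝ)) (b := T1)).exists_isMinOn
    ⟨0, le_rfl, by linarith⟩ (S.x_cont0.mono fun r hr => hr.1)
  have hxq := S.x_pos hq.1
  have hKP : 0 < K * Real.exp (-P) := mul_pos S.K_pos (Real.exp_pos _)
  set c := min (x q) (K * Real.exp (-P)) / 2 with hc
  have hc0 : 0 < c := by
    have := lt_min hxq hKP
    linarith
  have hc1 : c < x q := by
    have := min_le_left (x q) (K * Real.exp (-P))
    linarith
  have hc2 : c < K * Real.exp (-P) := by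
    have := min_le_right (x q) (K * Real.exp (-P))
    linarith
  have hini : ∀ r, 0 ≤ r → r ≤ T1 → c < x r := fun r h1 h2 =>
    lt_of_lt_of_le hc1 (isMinOn_iff.1 hqmin r ⟨h1, h2⟩)
  refine ⟨c, hc0, fun t ht => ?_⟩
  have := nich_first (f := fun r => c - x r) ht
    ((continuousOn_const.sub S.x_cont0).mono fun r hr => hr.1)
    (by have := hini 0 le_rfl (by linarith); simpa using this) (by
      intro s hs0 hst hlt hs
      have hxs : x s = c := by linarith
      have hsT : T1 < s := by
        by_contra h
        push Not at h
        have := hini s hs0.le h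
        linarith
      have hle : ∀ r, 0 ≤ r → r ≤ s → c ≤ x r := by
        intro r h1 h2
        rcases eq_or_lt_of_le h2 with h | h
        · rw [h, hxs]
        · linarith [hlt r h1 h]
      have hd := nich_deriv_nonneg hs0 (S.x_deriv s hs0).neg
        (fun r h1 h2 => by simp only [Pi.neg_apply]; rw [hxs]; linarith [hle r h1 h2.le])
      have hex : ∃ j, K ≤ x (s - σd j s) := by
        by_contra hno
        push Not at hno
        have h1 : δ s * c < ∑ j, p j s * x (s - τd j s) * Real.exp (-(a j s * x (s - σd j s))) := by
          have hne : (Finset.univ : Finset (Fin m)).Nonempty := by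
            by_contra hemp
            rw [Finset.not_nonempty_iff_eq_empty] at hemp
            have h6 := S.K1 s hs0.le
            rw [hemp, Finset.sum_empty] at h6
            linarith [S.δ_pos s hs0.le]
          rw [S.K1 s hs0.le, Finset.sum_mul]
          refine Finset.sum_lt_sum_of_nonempty hne fun j _ => ?_
          have hp := S.p_pos j s hs0.le
          obtain ⟨h2, h3⟩ := S.τd_bd j s hs0.le
          have ha := S.al_pos.trans_le (S.a_bd j s hs0.le).1
          have h4 := hle (s - τd j s) (by linarith) (by linarith)
          have h5 : Real.exp (-(a j s * K)) < Real.exp (-(a j s * x (s - σd j s))) := by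
            apply Real.exp_lt_exp.2
            have := mul_lt_mul_of_pos_left (hno j) ha
            linarith
          calc p j s * Real.exp (-(a j s * K)) * c
              = (p j s * c) * Real.exp (-(a j s * K)) := by ring
            _ < (p j s * c) * Real.exp (-(a j s * x (s - σd j s))) :=
                mul_lt_mul_of_pos_left h5 (by positivity)
            _ ≤ _ := mul_le_mul_of_nonneg_right (mul_le_mul_of_nonneg_left h4 hp.le)
                (Real.exp_pos _).le
        rw [hxs] at hd
        linarith
      obtain ⟨j, hj⟩ := hex
      obtain ⟨h2, h3⟩ := S.σd_bd j s hs0.le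
      have h4 := S.x_back (s := s - σd j s) (t := s) (by linarith) (by linarith) (by linarith)
      have h5 : K * Real.exp (-P) ≤ c := by
        rw [Real.exp_neg, ← div_eq_mul_inv, div_le_iff₀ (Real.exp_pos _)]
        rw [hxs] at h4
        linarith
      linarith)
  linarith

/-- forward growth bound -/
lemma x_forw (S : NichSetup m p a δ τd σd τ K al ap P T0 D Q x) {C s t : ℝ} (hs : τ ≤ s)
    (hst : s ≤ t) (hC : ∀ r, s - τ ≤ r → r ≤ s → x r < C) :
    x t < C * Real.exp (Q t - Q s) := by
  have hτ := S.τ_nonneg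
  have hs0 : 0 ≤ s := by linarith
  have hC0 : 0 < C := (S.x_pos hs0).trans (hC s (by linarith) le_rfl)
  have hcont : ContinuousOn (fun r => x r - C * Real.exp (Q r - Q s)) (Ici 0) :=
    S.x_cont0.sub (continuousOn_const.mul (S.Q_cont.sub continuousOn_const).rexp)
  have := nich_first (f := fun r => x r - C * Real.exp (Q r - Q s)) hst
    (hcont.mono fun r hr => hs0.trans hr.1)
    (by have := hC s (by linarith) le_rfl; simpa using this) (by
      intro u hsu hut hlt hu
      have hanti := nich_anti (f := fun r => x r - C * Real.exp (Q r - Q s)) hsu.le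
        (hcont.mono fun r hr => hs0.trans hr.1)
        (fun r hr => (S.x_deriv r (lt_of_le_of_lt hs0 hr.1)).sub
          ((((S.Q_deriv r (lt_of_le_of_lt hs0 hr.1)).sub_const (Q s)).exp).const_mul C))
        (by
          intro r hr
          have hr0 : 0 ≤ r := by linarith [hr.1]
          have hV : 1 ≤ Real.exp (Q r - Q s) := by
            rw [Real.one_le_exp_iff]
            linarith [S.Q_mono hs0 hr.1.le]
          have hsum : ∑ j, p j r * x (r - τd j r) * Real.exp (-(a j r * x (r - σd j r)))
              ≤ ∑ j, p j r * (C * Real.exp (Q r - Q s)) := by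
            refine Finset.sum_le_sum fun j _ => ?_
            have hp := S.p_pos j r hr0
            obtain ⟨h2, h3⟩ := S.τd_bd j r hr0
            obtain ⟨h2', h3'⟩ := S.σd_bd j r hr0
            have ha := S.al_pos.trans_le (S.a_bd j r hr0).1
            have hx1 : x (r - τd j r) ≤ C * Real.exp (Q r - Q s) := by
              rcases le_or_gt (r - τd j r) s with h | h
              · have := hC (r - τd j r) (by linarith [hr.1]) h
                nlinarith
              · have h7 := hlt (r - τd j r) h.le (by linarith [hr.2])
                have h8 : C * Real.exp (Q (r - τd j r) - Q s) ≤ C * Real.exp (Q r - Q s) :=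
                  mul_le_mul_of_nonneg_left (Real.exp_le_exp.2 (by
                    linarith [S.Q_mono (s := r - τd j r) (t := r) (by linarith) (by linarith)])) hC0.le
                linarith
            have hx0 := S.x_nonneg (t := r - τd j r) (by linarith)
            have hx2 := S.x_nonneg (t := r - σd j r) (by linarith)
            have he : Real.exp (-(a j r * x (r - σd j r))) ≤ 1 := by
              rw [Real.exp_le_one_iff]
              have := mul_nonneg ha.le hx2
              linarith
            calc p j r * x (r - τd j r) * Real.exp (-(a j r * x (r - σd j r)))
                ≤ p j r * x (r - τd j r) * 1 := mul_le_mul_of_nonneg_left he (by positivity)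
              _ ≤ _ := by rw [mul_one]; exact mul_le_mul_of_nonneg_left hx1 hp.le
          rw [← Finset.sum_mul] at hsum
          have := mul_pos (S.δ_pos r hr0) (S.x_pos hr0)
          linarith)
      have h9 := hC s (by linarith) le_rfl
      simp only [sub_self, Real.exp_zero, mul_one] at hanti
      linarith)
  linarith

lemma x_upper (S : NichSetup m p a δ τd σd τ K al ap P T0 D Q x) :
    ∃ hi, ∀ t, 0 ≤ t → x t ≤ hi := by
  have hT := S.T0_ge
  have hτ := S.τ_nonneg
  set T1 := T0 + τ + τ + 1 with hT1
  obtain ⟨q, hq, hqmax⟩ := (isCompact_Icc (a := (-τ:ℝ)) (b := T1)).exists_isMaxOn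
    ⟨0, by linarith, by linarith⟩ (S.x_cont.mono fun r hr => hr.1)
  set c := max (x q) ((K * Real.exp P + 1) * Real.exp P) + 1 with hc
  have hc1 : x q < c := by
    have := le_max_left (x q) ((K * Real.exp P + 1) * Real.exp P)
    linarith
  have hc2 : (K * Real.exp P + 1) * Real.exp P < c := by
    have := le_max_right (x q) ((K * Real.exp P + 1) * Real.exp P)
    linarith
  have hini : ∀ r, -τ ≤ r → r ≤ T1 → x r < c := fun r h1 h2 =>
    lt_of_le_of_lt (isMaxOn_iff.1 hqmax r ⟨h1, h2⟩) hc1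
  have hc0 : 0 < c := (S.x_pos le_rfl).trans (hini 0 (by linarith) (by linarith))
  refine ⟨c, fun t ht => ?_⟩
  have := nich_first (f := fun r => x r - c) (a := -τ) (b := t) (by linarith)
    ((S.x_cont.sub continuousOn_const).mono fun r hr => hr.1)
    (by have := hini (-τ) le_rfl (by linarith); simpa using this) (by
      intro s hs0' hst hlt hs
      have hxs : x s = c := by linarith
      have hsT : T1 < s := by
        by_contra h
        push Not at h
        have := hini s hs0'.le h
        linarith
      have hs0 : 0 < s := by linarith
      have hle : ∀ r, -τ ≤ r → r ≤ s → x r ≤ c := by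
        intro r h1 h2
        rcases eq_or_lt_of_le h2 with h | h
        · rw [h, hxs]
        · linarith [hlt r h1 h]
      have hd := nich_deriv_nonneg hs0 (S.x_deriv s hs0)
        (fun r h1 h2 => by rw [hxs]; exact hle r (by linarith) h2.le)
      have hex : ∃ j, x (s - σd j s) ≤ K := by
        by_contra hno
        push Not at hno
        have h1 : ∑ j, p j s * x (s - τd j s) * Real.exp (-(a j s * x (s - σd j s))) < δ s * c := by
          have hne : (Finset.univ : Finset (Fin m)).Nonempty := by
            by_contra hemp
            rw [Finset.not_nonempty_iff_eq_empty] at hemp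
            have h6 := S.K1 s hs0.le
            rw [hemp, Finset.sum_empty] at h6
            linarith [S.δ_pos s hs0.le]
          rw [S.K1 s hs0.le, Finset.sum_mul]
          refine Finset.sum_lt_sum_of_nonempty hne fun j _ => ?_
          have hp := S.p_pos j s hs0.le
          obtain ⟨h2, h3⟩ := S.τd_bd j s hs0.le
          have ha := S.al_pos.trans_le (S.a_bd j s hs0.le).1
          have h4 := hle (s - τd j s) (by linarith) (by linarith)
          have h5 : Real.exp (-(a j s * x (s - σd j s))) < Real.exp (-(a j s * K)) := by
            apply Real.exp_lt_exp.2
            have := mul_lt_mul_of_pos_left (hno j) ha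
            linarith
          calc p j s * x (s - τd j s) * Real.exp (-(a j s * x (s - σd j s)))
              ≤ p j s * c * Real.exp (-(a j s * x (s - σd j s))) :=
                mul_le_mul_of_nonneg_right (mul_le_mul_of_nonneg_left h4 hp.le)
                  (Real.exp_pos _).le
            _ < (p j s * c) * Real.exp (-(a j s * K)) :=
                mul_lt_mul_of_pos_left h5 (by positivity)
            _ = _ := by ring
        rw [hxs] at hd
        linarith
      obtain ⟨j, hj⟩ := hex
      obtain ⟨h2, h3⟩ := S.σd_bd j s hs0.le
      have h4 := S.x_forw (C := K * Real.exp P + 1) (s := s - σd j s) (t := s) (by linarith)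
        (by linarith) (by
          intro r hr1 hr2
          have h5 := S.x_back (s := r) (t := s - σd j s) (by linarith) hr1 hr2
          have h6 := mul_le_mul_of_nonneg_right hj (Real.exp_pos P).le
          linarith)
      have h7 := S.Q_short (s := s - σd j s) (t := s) (by linarith) (by linarith)
      have h8 : (K * Real.exp P + 1) * Real.exp (Q s - Q (s - σd j s))
          ≤ (K * Real.exp P + 1) * Real.exp P :=
        mul_le_mul_of_nonneg_left (Real.exp_le_exp.2 h7) (by
          have := mul_pos S.K_pos (Real.exp_pos P)
          linarith)
      linarith)
  linarith

/-- shift an eventual statement to the delayed argument -/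
lemma ev_shift {d : Fin m → ℝ → ℝ} (hd : ∀ j t, 0 ≤ t → 0 ≤ d j t ∧ d j t ≤ τ)
    {R : ℝ → Prop} (h : ∀ᶠ t in atTop, R t) : ∀ᶠ t in atTop, ∀ j, R (t - d j t) := by
  obtain ⟨T, hT⟩ := eventually_atTop.1 h
  filter_upwards [eventually_ge_atTop (T + τ), eventually_ge_atTop 0] with t ht ht0 j
  exact hT _ (by linarith [hd j t ht0])

/-- one-sided estimate of the production term from above -/
lemma sum_up (S : NichSetup m p a δ τd σd τ K al ap P T0 D Q x) {t hi E : ℝ} (ht : 0 ≤ t)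
    (hx : ∀ j, x (t - τd j t) ≤ hi) (hhi : 0 ≤ hi)
    (hE : ∀ j, a j t * (K - x (t - σd j t)) ≤ E) :
    (∑ j, p j t * x (t - τd j t) * Real.exp (-(a j t * x (t - σd j t)))) - δ t * x t
      ≤ δ t * (hi * Real.exp E - x t) := by
  have : ∑ j, p j t * x (t - τd j t) * Real.exp (-(a j t * x (t - σd j t)))
      ≤ δ t * (hi * Real.exp E) := by
    rw [S.K1 t ht, Finset.sum_mul]
    refine Finset.sum_le_sum fun j _ => ?_
    have hp := S.p_pos j t ht
    have e : Real.exp (-(a j t * x (t - σd j t))) ≤ Real.exp (-(a j t * K)) * Real.exp E := by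
      rw [← Real.exp_add]
      exact Real.exp_le_exp.2 (by linarith [hE j])
    calc p j t * x (t - τd j t) * Real.exp (-(a j t * x (t - σd j t)))
        ≤ p j t * hi * Real.exp (-(a j t * x (t - σd j t))) :=
          mul_le_mul_of_nonneg_right (mul_le_mul_of_nonneg_left (hx j) hp.le) (Real.exp_pos _).le
      _ ≤ p j t * hi * (Real.exp (-(a j t * K)) * Real.exp E) :=
          mul_le_mul_of_nonneg_left e (by positivity)
      _ = _ := by ring
  linarith

/-- one-sided estimate of the production term from below -/
lemma sum_lo (S : NichSetup m p a δ τd σd τ K al ap P T0 D Q x) {t lo E : ℝ} (ht : 0 ≤ t)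
    (hx : ∀ j, lo ≤ x (t - τd j t)) (hlo : 0 ≤ lo)
    (hE : ∀ j, E ≤ a j t * (K - x (t - σd j t))) :
    δ t * (lo * Real.exp E - x t) ≤
    (∑ j, p j t * x (t - τd j t) * Real.exp (-(a j t * x (t - σd j t)))) - δ t * x t := by
  have : δ t * (lo * Real.exp E) ≤
      ∑ j, p j t * x (t - τd j t) * Real.exp (-(a j t * x (t - σd j t))) := by
    rw [S.K1 t ht, Finset.sum_mul]
    refine Finset.sum_le_sum fun j _ => ?_
    have hp := S.p_pos j t ht
    have e : Real.exp (-(a j t * K)) * Real.exp E ≤ Real.exp (-(a j t * x (t - σd j t))) := by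
      rw [← Real.exp_add]
      exact Real.exp_le_exp.2 (by linarith [hE j])
    calc _ = p j t * lo * (Real.exp (-(a j t * K)) * Real.exp E) := by ring
      _ ≤ p j t * lo * Real.exp (-(a j t * x (t - σd j t))) :=
          mul_le_mul_of_nonneg_left e (by positivity)
      _ ≤ _ :=
          mul_le_mul_of_nonneg_right (mul_le_mul_of_nonneg_left (hx j) hp.le) (Real.exp_pos _).le
  linarith

lemma key_upper (S : NichSetup m p a δ τd σd τ K al ap P T0 D Q x) {lo hi η c Z : ℝ}
    (hlo : ∀ᶠ t in atTop, lo ≤ x t) (hhi : ∀ᶠ t in atTop, x t ≤ hi) (hloK : lo ≤ K)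
    (hhi0 : 0 ≤ hi) (hη : 0 ≤ η) (hf : ∃ᶠ t in atTop, c < x t)
    (hZ : ∀ᶠ t in atTop, ∀ j, D t - D (t - σd j t) ≤ Z)
    (hc : hi * Real.exp (-(al * η)) < c) (hk : K + η ≤ hi * Real.exp (ap * (K - lo))) :
    c ≤ hi * Real.exp (ap * (K - lo)) + (K + η - hi * Real.exp (ap * (K - lo))) * Real.exp (-Z) := by
  refine nich_osc S.σd_bd S.δ_pos S.D_deriv S.D_top S.x_deriv ?_ ?_ hZ hf hc hk
  · filter_upwards [ev_shift S.τd_bd hhi, ev_shift S.σd_bd hlo, eventually_ge_atTop 0]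
      with t h1 h2 h0
    refine S.sum_up h0 h1 hhi0 fun j => ?_
    have ⟨ha1, ha2⟩ := S.a_bd j t h0
    have hal := S.al_pos
    exact (mul_le_mul_of_nonneg_left (by linarith [h2 j] : K - x (t - σd j t) ≤ K - lo)
      (by linarith)).trans (mul_le_mul_of_nonneg_right ha2 (by linarith))
  · filter_upwards [ev_shift S.τd_bd hhi, eventually_ge_atTop 0] with t h1 h0 h2
    refine S.sum_up h0 h1 hhi0 fun j => ?_
    have ⟨ha1, ha2⟩ := S.a_bd j t h0
    have hal := S.al_pos
    have h3 : a j t * (K - x (t - σd j t)) ≤ a j t * (-η) :=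
      mul_le_mul_of_nonneg_left (by linarith [h2 j]) (by linarith)
    have h4 : al * η ≤ a j t * η := mul_le_mul_of_nonneg_right ha1 hη
    linarith

lemma key_lower (S : NichSetup m p a δ τd σd τ K al ap P T0 D Q x) {lo hi η c Z : ℝ}
    (hlo : ∀ᶠ t in atTop, lo ≤ x t) (hhi : ∀ᶠ t in atTop, x t ≤ hi) (hhiK : K ≤ hi)
    (hlo0 : 0 ≤ lo) (hη : 0 ≤ η) (hf : ∃ᶠ t in atTop, x t < c)
    (hZ : ∀ᶠ t in atTop, ∀ j, D t - D (t - σd j t) ≤ Z)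
    (hc : c < lo * Real.exp (al * η)) (hk : lo * Real.exp (ap * (K - hi)) ≤ K - η) :
    lo * Real.exp (ap * (K - hi)) + (K - η - lo * Real.exp (ap * (K - hi))) * Real.exp (-Z) ≤ c := by
  have := nich_osc (y := fun t => - x t) (k := -(K - η)) (c := -c) (B' := -(lo * Real.exp (al * η)))
    (B := -(lo * Real.exp (ap * (K - hi)))) S.σd_bd S.δ_pos S.D_deriv S.D_top
    (fun t ht => (S.x_deriv t ht).neg) ?_ ?_ hZ (by simpa using hf) (by linarith) (by linarith)
  · linarith
  · filter_upwards [ev_shift S.τd_bd hlo, ev_shift S.σd_bd hhi, eventually_ge_atTop 0]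
      with t h1 h2 h0
    have := S.sum_lo (E := ap * (K - hi)) h0 h1 hlo0 fun j => by
      have ⟨ha1, ha2⟩ := S.a_bd j t h0
      have hal := S.al_pos
      exact (mul_le_mul_of_nonpos_right ha2 (by linarith)).trans
        (mul_le_mul_of_nonneg_left (by linarith [h2 j]) (by linarith))
    linarith
  · filter_upwards [ev_shift S.τd_bd hlo, eventually_ge_atTop 0] with t h1 h0 h2
    have := S.sum_lo (E := al * η) h0 h1 hlo0 fun j => by
      have ⟨ha1, ha2⟩ := S.a_bd j t h0
      have hal := S.al_pos
      exact (mul_le_mul_of_nonneg_right ha1 hη).trans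
        (mul_le_mul_of_nonneg_left (by linarith [h2 j]) (by linarith))
    linarith

lemma conclusion (S : NichSetup m p a δ τd σd τ K al ap P T0 D Q x) {ζ : ℝ}
    (hζ : ∀ ε, 0 < ε → ∀ᶠ t in atTop, ∀ j, D t - D (t - σd j t) ≤ ζ + ε)
    (hK2 : ap * K * (Real.exp ζ - 1) ≤ 1) : Tendsto x atTop (nhds K) := by
  obtain ⟨lo, hlo0, hlo⟩ := S.x_lower
  obtain ⟨hi, hhi⟩ := S.x_upper
  have hbl : IsBoundedUnder (· ≥ ·) atTop x :=
    ⟨lo, by rw [eventually_map]; filter_upwards [eventually_ge_atTop 0] with t ht using hlo t ht⟩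
  have hbu : IsBoundedUnder (· ≤ ·) atTop x :=
    ⟨hi, by rw [eventually_map]; filter_upwards [eventually_ge_atTop 0] with t ht using hhi t ht⟩
  set U := limsup x atTop with hU
  set L := liminf x atTop with hL
  have hLU : L ≤ U := liminf_le_limsup hbu hbl
  have hL0 : 0 < L := by
    refine lt_of_lt_of_le hlo0 (le_liminf_of_le hbu.isCoboundedUnder_ge ?_)
    filter_upwards [eventually_ge_atTop 0] with t ht using hlo t ht
  have hUe : ∀ ε, 0 < ε → ∀ᶠ t in atTop, x t ≤ U + ε := fun ε hε =>
    (eventually_lt_of_limsup_lt (by linarith : limsup x atTop < U + ε) hbu).mono fun _ h => h.le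
  have hLe : ∀ ε, 0 < ε → ∀ᶠ t in atTop, L - ε ≤ x t := fun ε hε =>
    (eventually_lt_of_lt_liminf (by linarith : L - ε < liminf x atTop) hbl).mono fun _ h => h.le
  have hUf : ∀ ε, 0 < ε → ∃ᶠ t in atTop, U - ε < x t := fun ε hε =>
    frequently_lt_of_lt_limsup hbl.isCoboundedUnder_le (by linarith)
  have hLf : ∀ ε, 0 < ε → ∃ᶠ t in atTop, x t < L + ε := fun ε hε =>
    frequently_lt_of_liminf_lt hbu.isCoboundedUnder_ge (by linarith)
  have hK := S.K_pos
  have hal := S.al_pos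
  have hap := S.ap_pos
  set U' := max U K with hU'
  set L' := min L K with hL'
  have hL'0 : 0 < L' := lt_min hL0 hK
  -- upper inequality
  have ineqU : K < U → U ≤ U * Real.exp (ap * (K - L'))
      + (K - U * Real.exp (ap * (K - L'))) * Real.exp (-ζ) := by
    intro hKU
    have step : ∀ η, 0 < η → η < U - K → U ≤ U * Real.exp (ap * (K - L'))
        + (K + η - U * Real.exp (ap * (K - L'))) * Real.exp (-ζ) := by
      intro η hη hηU
      have hev : ∀ᶠ ε in nhdsWithin (0:ℝ) (Ioi 0), U - ε ≤ (U + ε) * Real.exp (ap * (K - (L' - ε)))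
          + (K + η - (U + ε) * Real.exp (ap * (K - (L' - ε)))) * Real.exp (-(ζ + ε)) := by
        have hsm : ∀ᶠ ε in nhds (0:ℝ), (U + ε) * Real.exp (-(al * η)) - (U - ε) < 0 := by
          have hcc : Continuous fun ε : ℝ => (U + ε) * Real.exp (-(al * η)) - (U - ε) := by fun_prop
          refine hcc.continuousAt.eventually_lt continuousAt_const ?_
          have : Real.exp (-(al * η)) < 1 := by
            rw [Real.exp_lt_one_iff]
            have := mul_pos hal hη
            linarith
          have hU0 : 0 < U := by linarith
          nlinarith
        filter_upwards [hsm.filter_mono nhdsWithin_le_nhds, self_mem_nhdsWithin] with ε h1 h2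
        have h2 : 0 < ε := h2
        refine S.key_upper ((hLe ε h2).mono fun t ht => ?_) (hUe ε h2) ?_ (by linarith) hη.le
          (hUf ε h2) (hζ ε h2) (by linarith) ?_
        · linarith [min_le_left L K]
        · linarith [min_le_right L K]
        · have : 1 ≤ Real.exp (ap * (K - (L' - ε))) := by
            rw [Real.one_le_exp_iff]
            exact mul_nonneg hap.le (by linarith [min_le_right L K])
          nlinarith
      have hc1 : Continuous fun ε : ℝ => U - ε := by fun_prop
      have hc2 : Continuous fun ε : ℝ => (U + ε) * Real.exp (ap * (K - (L' - ε)))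
          + (K + η - (U + ε) * Real.exp (ap * (K - (L' - ε)))) * Real.exp (-(ζ + ε)) := by fun_prop
      have := le_of_tendsto_of_tendsto ((hc1.tendsto 0).mono_left nhdsWithin_le_nhds)
        ((hc2.tendsto 0).mono_left nhdsWithin_le_nhds) hev
      simpa using this
    have hc2 : Continuous fun η : ℝ => U * Real.exp (ap * (K - L'))
        + (K + η - U * Real.exp (ap * (K - L'))) * Real.exp (-ζ) := by fun_prop
    have := ge_of_tendsto ((hc2.tendsto 0).mono_left (nhdsWithin_le_nhds (s := Ioi 0))) (by
      filter_upwards [Ioo_mem_nhdsGT (by linarith : (0:ℝ) < U - K)] with η hη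
      exact step η hη.1 hη.2)
    simpa using this
  have ineqL : L < K → L * Real.exp (ap * (K - U'))
      + (K - L * Real.exp (ap * (K - U'))) * Real.exp (-ζ) ≤ L := by
    intro hLK
    have step : ∀ η, 0 < η → η < K - L → L * Real.exp (ap * (K - U'))
        + (K - η - L * Real.exp (ap * (K - U'))) * Real.exp (-ζ) ≤ L := by
      intro η hη hηL
      have hev : ∀ᶠ ε in nhdsWithin (0:ℝ) (Ioi 0), (L - ε) * Real.exp (ap * (K - (U' + ε)))
          + (K - η - (L - ε) * Real.exp (ap * (K - (U' + ε)))) * Real.exp (-(ζ + ε)) ≤ L + ε := by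
        have hsm : ∀ᶠ ε in nhds (0:ℝ), (L + ε) - (L - ε) * Real.exp (al * η) < 0 := by
          have hcc : Continuous fun ε : ℝ => (L + ε) - (L - ε) * Real.exp (al * η) := by fun_prop
          refine hcc.continuousAt.eventually_lt continuousAt_const ?_
          have : 1 < Real.exp (al * η) := by
            rw [Real.one_lt_exp_iff]
            exact mul_pos hal hη
          nlinarith
        filter_upwards [hsm.filter_mono nhdsWithin_le_nhds, Ioo_mem_nhdsGT hL0] with ε h1 h2
        obtain ⟨h2, h3⟩ := h2
        refine S.key_lower (hLe ε h2) ((hUe ε h2).mono fun t ht => ?_) ?_ (by linarith) hη.le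
          (hLf ε h2) (hζ ε h2) (by linarith) ?_
        · linarith [le_max_left U K]
        · linarith [le_max_right U K]
        · have : Real.exp (ap * (K - (U' + ε))) ≤ 1 := by
            rw [Real.exp_le_one_iff]
            exact mul_nonpos_of_nonneg_of_nonpos hap.le (by linarith [le_max_right U K])
          nlinarith
      have hc1 : Continuous fun ε : ℝ => L + ε := by fun_prop
      have hc2 : Continuous fun ε : ℝ => (L - ε) * Real.exp (ap * (K - (U' + ε)))
          + (K - η - (L - ε) * Real.exp (ap * (K - (U' + ε)))) * Real.exp (-(ζ + ε)) := by fun_prop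
      have := le_of_tendsto_of_tendsto ((hc2.tendsto 0).mono_left nhdsWithin_le_nhds)
        ((hc1.tendsto 0).mono_left nhdsWithin_le_nhds) hev
      simpa using this
    have hc2 : Continuous fun η : ℝ => L * Real.exp (ap * (K - U'))
        + (K - η - L * Real.exp (ap * (K - U'))) * Real.exp (-ζ) := by fun_prop
    have := le_of_tendsto ((hc2.tendsto 0).mono_left (nhdsWithin_le_nhds (s := Ioi 0))) (by
      filter_upwards [Ioo_mem_nhdsGT (by linarith : (0:ℝ) < K - L)] with η hη
      exact step η hη.1 hη.2)
    simpa using this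
  -- clear denominators
  have heζ : Real.exp (-ζ) * Real.exp ζ = 1 := by rw [← Real.exp_add]; simp
  have hζpos := Real.exp_pos ζ
  have iU : K < U → U - K ≤ (Real.exp ζ - 1) * (U * (Real.exp (ap * (K - L')) - 1)) := by
    intro h
    have h1 := mul_le_mul_of_nonneg_right (ineqU h) hζpos.le
    have h2 : (U * Real.exp (ap * (K - L'))
      + (K - U * Real.exp (ap * (K - L'))) * Real.exp (-ζ)) * Real.exp ζ
      = U * Real.exp (ap * (K - L')) * Real.exp ζ + (K - U * Real.exp (ap * (K - L'))) := by
      rw [add_mul, mul_assoc (K - _), heζ, mul_one]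
    linarith
  have iL : L < K → K - L ≤ (Real.exp ζ - 1) * (L * (1 - Real.exp (ap * (K - U')))) := by
    intro h
    have h1 := mul_le_mul_of_nonneg_right (ineqL h) hζpos.le
    have h2 : (L * Real.exp (ap * (K - U'))
      + (K - L * Real.exp (ap * (K - U'))) * Real.exp (-ζ)) * Real.exp ζ
      = L * Real.exp (ap * (K - U')) * Real.exp ζ + (K - L * Real.exp (ap * (K - U'))) := by
      rw [add_mul, mul_assoc (K - _), heζ, mul_one]
    linarith
  have hend : K ≤ L ∧ U ≤ K := by
    rcases lt_or_ge K U with h1 | h1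
    · rcases lt_or_ge L K with h2 | h2
      · exfalso
        have eU : U' = U := max_eq_left h1.le
        have eL : L' = L := min_eq_left h2.le
        rw [eU] at iL
        rw [eL] at iU
        have jU := iU h1
        have jL := iL h2
        have hX : 0 ≤ Real.exp (ap * (K - L)) - 1 := by
          have : 1 ≤ Real.exp (ap * (K - L)) := by
            rw [Real.one_le_exp_iff]; exact mul_nonneg hap.le (by linarith)
          linarith
        have hY : 0 ≤ 1 - Real.exp (ap * (K - U)) := by
          have : Real.exp (ap * (K - U)) ≤ 1 := by
            rw [Real.exp_le_one_iff]
            exact mul_nonpos_of_nonneg_of_nonpos hap.le (by linarith)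
          linarith
        have kU : ap * K * (U - K) ≤ U * (Real.exp (ap * (K - L)) - 1) := by
          have e1 := mul_le_mul_of_nonneg_left jU (mul_pos hap hK).le
          have e2 := mul_le_mul_of_nonneg_right hK2
            (mul_nonneg (hK.le.trans h1.le) hX)
          linarith
        have kL : ap * K * (K - L) ≤ L * (1 - Real.exp (ap * (K - U))) := by
          have e1 := mul_le_mul_of_nonneg_left jL (mul_pos hap hK).le
          have e2 := mul_le_mul_of_nonneg_right hK2 (mul_nonneg hL0.le hY)
          linarith
        have hne : ap * K ≠ 0 := (mul_pos hap hK).ne'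
        refine nich_alg (A := ap * (U - K)) (B := ap * (K - L)) (k := 1 / (ap * K))
          (mul_pos hap (by linarith)) (mul_pos hap (by linarith)) (by positivity) ?_ ?_ ?_
        · rw [one_div, inv_mul_lt_iff₀ (mul_pos hap hK)]
          nlinarith
        · have e : (1 + 1 / (ap * K) * (ap * (U - K))) = U / K := by field_simp; ring
          rw [e, div_mul_eq_mul_div, le_div_iff₀ hK]
          linarith
        · have e : (1 - 1 / (ap * K) * (ap * (K - L))) = L / K := by field_simp; ring
          rw [e, div_mul_eq_mul_div, le_div_iff₀ hK]
          have e3 : -(ap * (U - K)) = ap * (K - U) := by ring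
          rw [e3]
          linarith
      · have eL : L' = K := min_eq_right h2
        have := iU h1
        rw [eL] at this
        simp at this
        linarith
    · refine ⟨?_, h1⟩
      by_contra h2
      push Not at h2
      have eU : U' = K := max_eq_right h1
      have := iL h2
      rw [eU] at this
      simp at this
      linarith
  exact tendsto_of_le_liminf_of_limsup_le hend.1 hend.2 hbu hbl

end NichSetup

lemma nich_integral_facts {f : ℝ → ℝ} (hf : ContinuousOn f (Ici 0)) :
    ContinuousOn (fun t => ∫ s in (0:ℝ)..t, f s) (Ici 0) ∧
    (∀ t, 0 < t → HasDerivAt (fun t => ∫ s in (0:ℝ)..t, f s) (f t) t) ∧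
    (∀ s t, 0 ≤ s → 0 ≤ t → (∫ r in s..t, f r) = (∫ r in (0:ℝ)..t, f r) - ∫ r in (0:ℝ)..s, f r) := by
  have hint : ∀ a b : ℝ, 0 ≤ a → 0 ≤ b → IntervalIntegrable f volume a b := fun a b ha hb =>
    (hf.mono (fun r hr => (le_min ha hb).trans hr.1)).intervalIntegrable
  refine ⟨?_, ?_, ?_⟩
  · intro t ht
    have ht : 0 ≤ t := ht
    have h1 : ContinuousOn (fun t => ∫ s in (0:ℝ)..t, f s) (uIcc 0 (t + 1)) :=
      intervalIntegral.continuousOn_primitive_interval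
        ((intervalIntegrable_iff' (by simp)).1 (hint 0 (t+1) le_rfl (by linarith)))
    rw [uIcc_of_le (by linarith)] at h1
    have := h1 t ⟨ht, by linarith⟩
    refine this.mono_of_mem_nhdsWithin ?_
    rw [mem_nhdsWithin]
    exact ⟨Iio (t+1), isOpen_Iio, by simp, fun r hr => ⟨hr.2, (mem_Iio.1 hr.1).le⟩⟩
  · intro t ht
    have hca : ContinuousAt f t := hf.continuousAt (Ici_mem_nhds ht)
    refine intervalIntegral.integral_hasDerivAt_right (hint 0 t le_rfl ht.le) ?_ hca
    exact (hf.mono Ioi_subset_Ici_self).stronglyMeasurableAtFilter isOpen_Ioi t ht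
  · intro s t hs ht
    rw [intervalIntegral.integral_interval_sub_left (hint 0 t le_rfl ht) (hint 0 s le_rfl hs)]

/-- Under (A0)--(A3), (K1) and (K2) `a⁺K(e^{ζ⁺} - 1) ≤ 1`, where
`ζ⁺ = max_j limsup_{t→∞} ∫_{t-σ_j(t)}^t δ(s) ds`, the positive equilibrium `K` of (*)
is globally attractive. -/
theorem global_attractivity_of_equilibrium
    (m : ℕ) (hm : 0 < m) (p a : Fin m → ℝ → ℝ) (δ : ℝ → ℝ)
    (τd σd : Fin m → ℝ → ℝ) (τ : ℝ)
    (hA0 : HypA0 m p a δ τd σd) (hτ : IsMaxDelay m τd σd τ)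
    (hA1 : HypA1 m p δ) (hA2 : HypA2 m p τ) (hA3 : HypA3 δ)
    (aplus : ℝ)
    (haplus : IsLUB {r : ℝ | ∃ j : Fin m, ∃ t : ℝ, 0 ≤ t ∧ r = a j t} aplus)
    (K : ℝ) (hKpos : 0 < K)
    (hK1 : ∀ t ≥ (0:ℝ), δ t = ∑ j, p j t * Real.exp (-(a j t * K)))
    (ζplus : ℝ)
    (hζ : IsGreatest {r : ℝ | ∃ j : Fin m,
        r = Filter.limsup (fun t => ∫ s in (t - σd j t)..t, δ s) Filter.atTop} ζplus)
    (hK2 : aplus * K * (Real.exp ζplus - 1) ≤ 1) :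
    ∀ x : ℝ → ℝ, IsPosSol m p a δ τd σd τ x →
      Filter.Tendsto x Filter.atTop (nhds K) := by
  intro x hx
  obtain ⟨hp, ha, ⟨hδc, hδ⟩, hd⟩ := hA0
  obtain ⟨hxc, hxi, hx0, hxd⟩ := hx
  have hpc : ContinuousOn (fun t => ∑ j, p j t) (Ici 0) :=
    continuousOn_finsetSum _ fun j _ => (hp j).1
  obtain ⟨Dc, Dd, Di⟩ := nich_integral_facts hδc
  obtain ⟨Qc, Qd, Qi⟩ := nich_integral_facts hpc
  have hτd : ∀ j t, 0 ≤ t → 0 ≤ τd j t ∧ τd j t ≤ τ := fun j t ht =>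
    ⟨((hd j).2.2.1 t ht).1, hτ.1 ⟨j, t, ht, Or.inl rfl⟩⟩
  have hσd : ∀ j t, 0 ≤ t → 0 ≤ σd j t ∧ σd j t ≤ τ := fun j t ht =>
    ⟨((hd j).2.2.1 t ht).2, hτ.1 ⟨j, t, ht, Or.inr rfl⟩⟩
  have hτ0 : 0 ≤ τ := by
    have := hτd ⟨0, hm⟩ 0 le_rfl
    linarith
  choose ac aC hac hab using fun j => (ha j).2
  have : Nonempty (Fin m) := ⟨⟨0, hm⟩⟩
  obtain ⟨j0, hj0⟩ := Finite.exists_min ac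
  have hab' : ∀ j t, 0 ≤ t → ac j0 ≤ a j t ∧ a j t ≤ aplus := fun j t ht =>
    ⟨(hj0 j).trans (hab j t ht).1, haplus.1 ⟨j, t, ht, rfl⟩⟩
  obtain ⟨P, hP⟩ := hA2
  rw [eventually_map] at hP
  obtain ⟨T, hT⟩ := eventually_atTop.1 hP
  have S : NichSetup m p a δ τd σd τ K (ac j0) aplus P (max T τ)
      (fun t => ∫ s in (0:ℝ)..t, δ s) (fun t => ∫ s in (0:ℝ)..t, ∑ j, p j s) x :=
    { p_pos := fun j t ht => (hp j).2 t ht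
      al_pos := hac j0
      ap_pos := (hac j0).trans_le ((hab' j0 0 le_rfl).1.trans (hab' j0 0 le_rfl).2)
      a_bd := hab'
      δ_pos := hδ
      τ_nonneg := hτ0
      τd_bd := hτd
      σd_bd := hσd
      K_pos := hKpos
      K1 := hK1
      D_cont := Dc
      D_deriv := Dd
      D_top := hA3
      Q_cont := Qc
      Q_deriv := Qd
      T0_ge := le_max_right _ _
      Q_bd := by
        intro t ht
        have h1 := (le_max_left T τ).trans ht
        have h2 := (le_max_right T τ).trans ht
        have := hT t h1
        simp only at this
        rwa [Qi (t - τ) t (by linarith) (by linarith)] at this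
      x_cont := hxc
      x_history := fun θ h1 h2 => hxi θ ⟨h1, h2⟩
      x_zero := hx0
      x_deriv := fun t ht => (hxd t ht.le).hasDerivAt (Ici_mem_nhds ht) }
  refine S.conclusion (ζ := ζplus) ?_ hK2
  intro ε hε
  rw [eventually_all]
  intro j
  have hle : limsup (fun t => ∫ s in (t - σd j t)..t, δ s) atTop ≤ ζplus := hζ.2 ⟨j, rfl⟩
  have hbd : IsBoundedUnder (· ≤ ·) atTop (fun t => ∫ s in (t - σd j t)..t, δ s) := by
    refine ⟨P, ?_⟩
    rw [eventually_map]
    filter_upwards [eventually_ge_atTop (max T τ)] with t ht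
    have h2 := (le_max_right T τ).trans ht
    have h3 := hσd j t (by linarith)
    rw [Di (t - σd j t) t (by linarith) (by linarith)]
    exact (S.D_le_Q (by linarith) (by linarith)).trans (S.Q_short ht (by linarith))
  filter_upwards [eventually_lt_of_limsup_lt (lt_of_le_of_lt hle (by linarith : ζplus < ζplus + ε)) hbd,
    eventually_ge_atTop τ] with t ht h2
  have h3 := hσd j t (by linarith)
  rw [Di (t - σd j t) t (by linarith) (by linarith)] at ht
  exact ht.le
end
end

section
/- Assume (A0), (A1), (A2), (A3), (K1) and (K2*): (a⁺/a⁻)(e^{ζ⁺} − 1) log γ ≤ 1, where ζ⁺ = max_{1≤j≤m} limsup_{t→∞} ∫_{t−σ_j(t)}^t δ(s) ds and γ = limsup_{t→∞} p(t)/δ(t). Then the positive equilibrium K of equation (*) is globally attractive: every positive solution x satisfies lim_{t→∞} x(t) = K. -/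
open Real Filter MeasureTheory Set

noncomputable section

/-- Scalar inequality closing the argument. -/
lemma scalar_aux (w A : ℝ) (hw : 0 < w) (hA : 0 < A) :
    (1 - exp (-A)) / (1 + w * (1 - exp (-A))) < log (1 + w * A + A) - log (1 + w * A) := by
  have key : StrictMonoOn (fun A : ℝ => log (1 + w * A + A) - log (1 + w * A)
      - (1 - exp (-A)) / (1 + w * (1 - exp (-A)))) (Ici 0) := by
    have hE : ∀ y : ℝ, 0 ≤ y → 0 ≤ 1 - exp (-y) := by
      intro y hy
      have : exp (-y) ≤ 1 := exp_le_one_iff.mpr (by linarith)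
      linarith
    have hder : ∀ y : ℝ, 0 ≤ y → HasDerivAt (fun A : ℝ => log (1 + w * A + A) - log (1 + w * A)
      - (1 - exp (-A)) / (1 + w * (1 - exp (-A))))
        ((w + 1) / (1 + w * y + y) - w / (1 + w * y) -
          exp (-y) / (1 + w * (1 - exp (-y))) ^ 2) y := by
      intro y hy
      have h1 : 0 < 1 + w * y := by positivity
      have h2 : 0 < 1 + w * y + y := by positivity
      have h3 : 0 < 1 + w * (1 - exp (-y)) := by
        have := mul_nonneg hw.le (hE y hy); linarith
      have d1 : HasDerivAt (fun A : ℝ => 1 + w * A) w y := by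
        simpa using ((hasDerivAt_id y).const_mul w).const_add 1
      have d2 : HasDerivAt (fun A : ℝ => 1 + w * A + A) (w + 1) y := d1.add (hasDerivAt_id y)
      have d3 : HasDerivAt (fun A : ℝ => 1 - exp (-A)) (exp (-y)) y := by
        simpa using ((hasDerivAt_id y).neg.exp).const_sub 1
      have d4 : HasDerivAt (fun A : ℝ => 1 + w * (1 - exp (-A))) (w * exp (-y)) y :=
        (d3.const_mul w).const_add 1
      have := ((d2.log h2.ne').sub (d1.log h1.ne')).sub (d3.div d4 h3.ne')
      refine this.congr_deriv ?_
      congr 2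
      ring
    apply strictMonoOn_of_deriv_pos (convex_Ici 0)
    · intro y hy
      exact (hder y hy).continuousAt.continuousWithinAt
    · intro y hy
      rw [interior_Ici] at hy
      have hy : 0 < y := hy
      rw [(hder y hy.le).deriv]
      have h1 : 0 < 1 + w * y := by positivity
      have h2 : 0 < 1 + w * y + y := by positivity
      have h3 : 0 < 1 + w * (1 - exp (-y)) := by
        have := mul_nonneg hw.le (hE y hy.le); linarith
      have e1 : (w + 1) / (1 + w * y + y) - w / (1 + w * y) =
          1 / ((1 + w * y) * (1 + w * y + y)) := by
        field_simp; ring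
      rw [e1, sub_pos, div_lt_div_iff₀ (by positivity) (by positivity)]
      obtain ⟨u, hu⟩ : ∃ u, u = exp (y / 2) := ⟨_, rfl⟩
      have hup : 0 < u := hu ▸ exp_pos _
      have hexp : exp (-y) = 1 / u ^ 2 := by
        rw [hu, ← exp_nat_mul, exp_neg]; push_cast; rw [one_div]; congr 2; ring
      have hu1 : 1 + y / 2 < u := by
        have := add_one_lt_exp (x := y / 2) (by positivity); rw [hu]; linarith
      have hu2 : 1 + y < u ^ 2 := by
        rw [hu, ← exp_nat_mul]
        have := add_one_lt_exp (x := y) (by positivity)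
        have e : ((2 : ℕ) : ℝ) * (y / 2) = y := by push_cast; ring
        rw [e]; linarith
      -- u - 1/u ≥ y
      have hsinh : y ≤ u - 1 / u := by
        have := self_le_sinh_iff.mpr (show (0:ℝ) ≤ y / 2 by positivity)
        rw [sinh_eq] at this
        rw [exp_neg, ← hu] at this
        rw [one_div]; linarith
      have hX : u + w * y ≤ u * (1 + w * (1 - 1 / u ^ 2)) := by
        have : u * (1 + w * (1 - 1 / u ^ 2)) = u + w * (u - 1 / u) := by field_simp
        rw [this]; nlinarith
      rw [hexp] at h3 ⊢
      have hsq : (u + w * y) ^ 2 ≤ (u * (1 + w * (1 - 1 / u ^ 2))) ^ 2 :=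
        pow_le_pow_left₀ (by positivity) hX 2
      have hlt : (1 + w * y) * (1 + w * y + y) < (u + w * y) ^ 2 := by
        have : 0 < w * y * (u - (1 + y / 2)) := mul_pos (by positivity) (by linarith)
        nlinarith
      have : (1 + w * y) * (1 + w * y + y) < u ^ 2 * (1 + w * (1 - 1 / u ^ 2)) ^ 2 := by
        rw [← mul_pow]; linarith
      rw [one_div, inv_mul_eq_div, div_lt_iff₀ (by positivity)]
      rw [one_div] at this
      linarith
  have := key (self_mem_Ici) (show A ∈ Ici 0 from hA.le) hA
  simp at this
  linarith

lemma scalar_final (a K l L θ : ℝ) (ha : 0 < a) (hK : 0 < K) (hl : 0 < l) (hlK : l ≤ K)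
    (hKL : K ≤ L) (hθ : a * K * θ ≤ 1)
    (hU : L * (1 + θ) ≤ K + L * exp (a * (K - l)) * θ)
    (hD : K + l * exp (-(a * (L - K))) * θ ≤ l * (1 + θ)) : l = K ∧ L = K := by
  have hk : 0 < a * K := by positivity
  set A := a * (L - K) with hA
  set B := a * (K - l) with hB
  have hA0 : 0 ≤ A := mul_nonneg ha.le (by linarith)
  have hB0 : 0 ≤ B := mul_nonneg ha.le (by linarith)
  have hE0 : 0 ≤ 1 - exp (-A) := by
    have : exp (-A) ≤ 1 := exp_le_one_iff.mpr (by linarith)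
    linarith
  have hF0 : 0 ≤ exp B - 1 := by
    have : 1 ≤ exp B := one_le_exp hB0
    linarith
  have hθ' : θ ≤ 1 / (a * K) := by rw [le_div_iff₀ hk]; linarith
  set w := 1 / (a * K) with hw
  have hwp : 0 < w := by positivity
  have hwK : w * (a * K) = 1 := by rw [hw]; field_simp
  -- first inequality
  have h1 : A ≤ (1 + w * A) * (exp B - 1) := by
    have e1 : L - K ≤ L * (exp B - 1) * θ := by linarith
    have e2 : L * (exp B - 1) * θ ≤ L * (exp B - 1) * w :=
      mul_le_mul_of_nonneg_left hθ' (mul_nonneg (by linarith) hF0)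
    have e3 : a * (L - K) ≤ a * (L * (exp B - 1) * w) := mul_le_mul_of_nonneg_left (by linarith) ha.le
    have e4 : 1 + w * A = a * L * w := by rw [hA]; linear_combination -hwK
    rw [e4]; linarith
  have h2 : B * (1 + w * (1 - exp (-A))) ≤ 1 - exp (-A) := by
    have e1 : K - l ≤ l * (1 - exp (-A)) * θ := by linarith
    have e2 : l * (1 - exp (-A)) * θ ≤ l * (1 - exp (-A)) * w :=
      mul_le_mul_of_nonneg_left hθ' (mul_nonneg hl.le hE0)
    have e3 : a * (K - l) ≤ a * (l * (1 - exp (-A)) * w) := mul_le_mul_of_nonneg_left (by linarith) ha.le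
    have e4 : 1 - w * B = a * l * w := by rw [hB]; linear_combination -hwK
    have : B ≤ (1 - w * B) * (1 - exp (-A)) := by rw [e4]; linarith
    linarith
  have hAz : A = 0 := by
    by_contra hne
    have hApos : 0 < A := lt_of_le_of_ne hA0 (Ne.symm hne)
    have h3 := scalar_aux w A hwp hApos
    have p1 : 0 < 1 + w * A := by positivity
    have p2 : 0 < 1 + w * A + A := by positivity
    have p3 : 0 < 1 + w * (1 - exp (-A)) := by
      have := mul_nonneg hwp.le hE0; linarith
    have hB1 : B ≤ (1 - exp (-A)) / (1 + w * (1 - exp (-A))) := by rwa [le_div_iff₀ p3]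
    have hB2 : log (1 + w * A + A) - log (1 + w * A) ≤ B := by
      rw [sub_le_iff_le_add, log_le_iff_le_exp p2, exp_add, exp_log p1]
      linarith
    linarith
  have hBz : B = 0 := by
    rw [hAz] at h2; simp at h2; linarith
  constructor
  · have := (mul_eq_zero.mp (hB ▸ hBz)).resolve_left ha.ne'; linarith
  · have := (mul_eq_zero.mp (hA ▸ hAz)).resolve_left ha.ne'; linarith

/-- Left derivative at a left-maximum is nonnegative. -/
lemma deriv_nonneg_of_left_max {f : ℝ → ℝ} {d s T : ℝ} (hs : s < T) (hf : HasDerivAt f d T)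
    (hmax : ∀ r, s ≤ r → r ≤ T → f r ≤ f T) : 0 ≤ d := by
  have h := (hasDerivAt_iff_tendsto_slope.mp hf).mono_left
    (nhdsWithin_mono T (fun y (hy : y ∈ Iio T) => ne_of_lt hy))
  apply ge_of_tendsto h
  filter_upwards [Ioo_mem_nhdsLT hs] with r hr
  rw [slope_def_field]
  apply div_nonneg_of_nonpos
  · linarith [hmax r hr.1.le hr.2.le]
  · linarith [hr.2]

lemma deriv_nonpos_of_left_min {f : ℝ → ℝ} {d s T : ℝ} (hs : s < T) (hf : HasDerivAt f d T)
    (hmin : ∀ r, s ≤ r → r ≤ T → f T ≤ f r) : d ≤ 0 := by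
  have := deriv_nonneg_of_left_max hs hf.neg (fun r h1 h2 => neg_le_neg (hmin r h1 h2))
  linarith

/-- Comparison for the differential inequality dx/dt ≤ δ (M - x). -/
lemma comparison_up {x d D δ : ℝ → ℝ} {M s t : ℝ} (hst : s ≤ t)
    (hc : ContinuousOn x (Icc s t)) (hDc : ContinuousOn D (Icc s t))
    (hx : ∀ r ∈ Ioo s t, HasDerivAt x (d r) r) (hD : ∀ r ∈ Ioo s t, HasDerivAt D (δ r) r)
    (h : ∀ r ∈ Ioo s t, d r ≤ δ r * (M - x r)) :
    x t ≤ M + (x s - M) * exp (-(D t - D s)) := by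
  have key : AntitoneOn (fun r => (x r - M) * exp (D r)) (Icc s t) := by
    have hd : ∀ r ∈ Ioo s t, HasDerivAt (fun r => (x r - M) * exp (D r))
        (d r * exp (D r) + (x r - M) * (exp (D r) * δ r)) r := fun r hr =>
      ((hx r hr).sub_const M).mul ((hD r hr).exp)
    apply antitoneOn_of_deriv_nonpos (convex_Icc s t)
    · exact (hc.sub continuousOn_const).mul hDc.rexp
    · intro r hr
      rw [interior_Icc] at hr
      exact (hd r hr).differentiableAt.differentiableWithinAt
    · intro r hr
      rw [interior_Icc] at hr
      rw [(hd r hr).deriv]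
      have := h r hr
      have h2 : (d r - δ r * (M - x r)) * exp (D r) ≤ 0 :=
        mul_nonpos_of_nonpos_of_nonneg (by linarith) (exp_pos _).le
      linarith
  have h1 := key (left_mem_Icc.mpr hst) (right_mem_Icc.mpr hst) hst
  simp only at h1
  have e : exp (-(D t - D s)) = exp (D s) * exp (-D t) := by rw [← exp_add]; congr 1; ring
  have h2 := mul_le_mul_of_nonneg_right h1 (exp_pos (-D t)).le
  have e2 : exp (D t) * exp (-D t) = 1 := by rw [← exp_add]; simp
  rw [e]
  have : (x t - M) * exp (D t) * exp (-D t) = x t - M := by rw [mul_assoc, e2, mul_one]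
  rw [this] at h2
  linarith

lemma comparison_down {x d D δ : ℝ → ℝ} {M s t : ℝ} (hst : s ≤ t)
    (hc : ContinuousOn x (Icc s t)) (hDc : ContinuousOn D (Icc s t))
    (hx : ∀ r ∈ Ioo s t, HasDerivAt x (d r) r) (hD : ∀ r ∈ Ioo s t, HasDerivAt D (δ r) r)
    (h : ∀ r ∈ Ioo s t, δ r * (M - x r) ≤ d r) :
    M + (x s - M) * exp (-(D t - D s)) ≤ x t := by
  have := comparison_up (x := fun r => - x r) (d := fun r => - d r) (M := -M) hst hc.neg hDc
    (fun r hr => (hx r hr).neg) hD (fun r hr => by linarith [h r hr])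
  linarith

/-- Fluctuation lemma. -/
lemma fluct_up {x d D δ : ℝ → ℝ} {c ε : ℝ} (hε : 0 < ε)
    (hx : ∀ r > 0, HasDerivAt x (d r) r) (hD : ∀ r > 0, HasDerivAt D (δ r) r)
    (hδ : ∀ r > 0, 0 < δ r) (hDt : Tendsto D atTop atTop)
    (hf : ∃ᶠ t in atTop, c < x t) (T : ℝ) (hT : 0 < T) :
    ∃ t ≥ T, c ≤ x t ∧ -(ε * δ t) ≤ d t := by
  by_contra hcon
  push Not at hcon
  by_cases hbelow : ∃ t1 ≥ T, x t1 < c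
  · obtain ⟨t1, ht1, hx1⟩ := hbelow
    apply hf
    filter_upwards [eventually_ge_atTop t1] with t ht
    rw [not_lt]
    refine image_le_of_deriv_right_lt_deriv_boundary (f := x) (f' := d) (a := t1) (b := t)
      (B := fun _ => c) (B' := fun _ => 0) ?_ ?_ hx1.le ?_ ?_ (right_mem_Icc.mpr ht)
    · intro r hr
      exact (hx r (by linarith [hr.1])).continuousAt.continuousWithinAt
    · intro r hr
      exact (hx r (by linarith [hr.1])).hasDerivWithinAt
    · intro r
      exact hasDerivAt_const r c
    · intro r hr hrc
      have h1 := hcon r (by linarith [hr.1]) hrc.ge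
      have h2 := mul_pos hε (hδ r (by linarith [hr.1]))
      linarith
  · push Not at hbelow
    have hanti : ∀ t ≥ T, x t + ε * D t ≤ x T + ε * D T := by
      intro t ht
      have hd : ∀ r ≥ T, HasDerivAt (fun r => x r + ε * D r) (d r + ε * δ r) r := fun r hr =>
        (hx r (by linarith)).add ((hD r (by linarith)).const_mul ε)
      have : AntitoneOn (fun r => x r + ε * D r) (Ici T) := by
        apply antitoneOn_of_deriv_nonpos (convex_Ici T)
        · intro r hr; exact (hd r hr).continuousAt.continuousWithinAt
        · intro r hr
          rw [interior_Ici] at hr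
          exact (hd r (le_of_lt hr)).differentiableAt.differentiableWithinAt
        · intro r hr
          rw [interior_Ici] at hr
          have hr' : T ≤ r := le_of_lt hr
          rw [(hd r hr').deriv]
          linarith [hcon r hr' (hbelow r hr')]
      exact this self_mem_Ici (show t ∈ Ici T from ht) ht
    obtain ⟨t, ht, htD⟩ := ((eventually_ge_atTop T).and
      (hDt.eventually_gt_atTop ((x T + ε * D T - c) / ε))).exists
    have h1 := hanti t ht
    have h2 := hbelow t ht
    rw [div_lt_iff₀ hε] at htD
    linarith

lemma fluct_down {x d D δ : ℝ → ℝ} {c ε : ℝ} (hε : 0 < ε)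
    (hx : ∀ r > 0, HasDerivAt x (d r) r) (hD : ∀ r > 0, HasDerivAt D (δ r) r)
    (hδ : ∀ r > 0, 0 < δ r) (hDt : Tendsto D atTop atTop)
    (hf : ∃ᶠ t in atTop, x t < c) (T : ℝ) (hT : 0 < T) :
    ∃ t ≥ T, x t ≤ c ∧ d t ≤ ε * δ t := by
  obtain ⟨t, h1, h2, h3⟩ := fluct_up (x := fun r => - x r) (d := fun r => - d r) (c := -c) hε
    (fun r hr => (hx r hr).neg) hD hδ hDt (hf.mono (fun t ht => neg_lt_neg ht)) T hT
  exact ⟨t, h1, by linarith, by linarith⟩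

/-- Right-hand side of the Nicholson equation. -/
def nrhs {m : ℕ} (p a τd σd : Fin m → ℝ → ℝ) (δ x : ℝ → ℝ) (t : ℝ) : ℝ :=
  (∑ j, p j t * x (t - τd j t) * Real.exp (-(a j t * x (t - σd j t)))) - δ t * x t

/-- Working hypotheses in convenient form. -/
structure Nich {m : ℕ} (p a τd σd : Fin m → ℝ → ℝ) (δ x D P : ℝ → ℝ)
    (τ am ap K C T0 : ℝ) : Prop where
  hp : ∀ j, ∀ t ≥ 0, 0 < p j t
  ham : 0 < am
  ha : ∀ j, ∀ t ≥ 0, am ≤ a j t ∧ a j t ≤ ap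
  hδ : ∀ t ≥ 0, 0 < δ t
  hτ : 0 ≤ τ
  hdel : ∀ j, ∀ t ≥ 0, 0 ≤ τd j t ∧ τd j t ≤ τ ∧ 0 ≤ σd j t ∧ σd j t ≤ τ
  hK : 0 < K
  hK1 : ∀ t ≥ (0:ℝ), δ t = ∑ j, p j t * Real.exp (-(a j t * K))
  hD : ∀ t ≥ 0, HasDerivAt D (δ t) t
  hP : ∀ t ≥ 0, HasDerivAt P (∑ j, p j t) t
  hDt : Tendsto D atTop atTop
  hT0 : 0 ≤ T0
  hC : ∀ t ≥ T0, P t - P (t - τ) ≤ C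
  xc : ContinuousOn x (Ici (-τ))
  x_nonneg : ∀ θ ∈ Ico (-τ) (0:ℝ), 0 ≤ x θ
  x0 : 0 < x 0
  hx : ∀ t > 0, HasDerivAt x (nrhs p a τd σd δ x t) t

namespace Nich

variable {m : ℕ} {p a τd σd : Fin m → ℝ → ℝ} {δ x D P : ℝ → ℝ} {τ am ap K C T0 : ℝ}

lemma rhs_le (h : Nich p a τd σd δ x D P τ am ap K C T0) {t B c : ℝ} (ht : 0 ≤ t) (hB : 0 ≤ B)
    (h1 : ∀ j, x (t - τd j t) ≤ B) (h2 : ∀ j, -(a j t * (x (t - σd j t) - K)) ≤ c) :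
    nrhs p a τd σd δ x t ≤ δ t * (B * exp c - x t) := by
  have : (∑ j, p j t * x (t - τd j t) * Real.exp (-(a j t * x (t - σd j t)))) ≤
      B * exp c * δ t := by
    rw [h.hK1 t ht, Finset.mul_sum]
    apply Finset.sum_le_sum
    intro j _
    have hp := h.hp j t ht
    have e1 : exp (-(a j t * x (t - σd j t))) ≤ exp c * exp (-(a j t * K)) := by
      rw [← exp_add]; apply exp_le_exp.mpr; linarith [h2 j]
    calc p j t * x (t - τd j t) * Real.exp (-(a j t * x (t - σd j t)))
        ≤ p j t * B * (exp c * exp (-(a j t * K))) := by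
          apply mul_le_mul _ e1 (exp_pos _).le (by positivity)
          exact mul_le_mul_of_nonneg_left (h1 j) hp.le
      _ = _ := by ring
  unfold nrhs; linarith

lemma rhs_ge (h : Nich p a τd σd δ x D P τ am ap K C T0) {t B c : ℝ} (ht : 0 ≤ t) (hB : 0 ≤ B)
    (h1 : ∀ j, B ≤ x (t - τd j t)) (h2 : ∀ j, c ≤ -(a j t * (x (t - σd j t) - K))) :
    δ t * (B * exp c - x t) ≤ nrhs p a τd σd δ x t := by
  have : B * exp c * δ t ≤
      (∑ j, p j t * x (t - τd j t) * Real.exp (-(a j t * x (t - σd j t)))) := by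
    rw [h.hK1 t ht, Finset.mul_sum]
    apply Finset.sum_le_sum
    intro j _
    have hp := h.hp j t ht
    have e1 : exp c * exp (-(a j t * K)) ≤ exp (-(a j t * x (t - σd j t))) := by
      rw [← exp_add]; apply exp_le_exp.mpr; linarith [h2 j]
    calc B * exp c * (p j t * exp (-(a j t * K))) = p j t * B * (exp c * exp (-(a j t * K))) := by
          ring
      _ ≤ _ := by
          apply mul_le_mul _ e1 (by positivity) (mul_nonneg hp.le (hB.trans (h1 j)))
          exact mul_le_mul_of_nonneg_left (h1 j) hp.le
  unfold nrhs; linarith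

lemma xc' (h : Nich p a τd σd δ x D P τ am ap K C T0) {s t : ℝ} (hs : 0 ≤ s) :
    ContinuousOn x (Icc s t) :=
  h.xc.mono (fun r hr => by have := h.hτ; simp only [mem_Ici]; linarith [hr.1])

lemma Dc (h : Nich p a τd σd δ x D P τ am ap K C T0) {s t : ℝ} (hs : 0 ≤ s) :
    ContinuousOn D (Icc s t) :=
  fun r hr => (h.hD r (hs.trans hr.1)).continuousAt.continuousWithinAt

lemma comp_up (h : Nich p a τd σd δ x D P τ am ap K C T0) {s t M : ℝ} (hs : 0 ≤ s) (hst : s ≤ t)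
    (hr : ∀ r, s < r → r < t → nrhs p a τd σd δ x r ≤ δ r * (M - x r)) :
    x t ≤ M + (x s - M) * exp (-(D t - D s)) :=
  comparison_up hst (h.xc' hs) (h.Dc hs) (fun r hr => h.hx r (by linarith [hr.1]))
    (fun r hr => h.hD r (by linarith [hr.1])) (fun r h' => hr r h'.1 h'.2)

lemma comp_down (h : Nich p a τd σd δ x D P τ am ap K C T0) {s t M : ℝ} (hs : 0 ≤ s) (hst : s ≤ t)
    (hr : ∀ r, s < r → r < t → δ r * (M - x r) ≤ nrhs p a τd σd δ x r) :
    M + (x s - M) * exp (-(D t - D s)) ≤ x t :=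
  comparison_down hst (h.xc' hs) (h.Dc hs) (fun r hr => h.hx r (by linarith [hr.1]))
    (fun r hr => h.hD r (by linarith [hr.1])) (fun r h' => hr r h'.1 h'.2)

lemma rhs_ge_zero (h : Nich p a τd σd δ x D P τ am ap K C T0) {t : ℝ} (ht : 0 ≤ t)
    (h1 : ∀ j, 0 ≤ x (t - τd j t)) : δ t * (0 - x t) ≤ nrhs p a τd σd δ x t := by
  unfold nrhs
  have : 0 ≤ (∑ j, p j t * x (t - τd j t) * Real.exp (-(a j t * x (t - σd j t)))) :=
    Finset.sum_nonneg (fun j _ => mul_nonneg (mul_nonneg (h.hp j t ht).le (h1 j)) (exp_pos _).le)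
  linarith

lemma pos (h : Nich p a τd σd δ x D P τ am ap K C T0) : ∀ t ≥ 0, 0 < x t := by
  intro t ht
  by_contra hcon
  rw [not_lt] at hcon
  have hcomp : IsCompact (Icc 0 t ∩ x ⁻¹' (Iic 0)) := by
    apply IsCompact.of_isClosed_subset isCompact_Icc _ inter_subset_left
    exact (h.xc' le_rfl).preimage_isClosed_of_isClosed isClosed_Icc isClosed_Iic
  obtain ⟨t0, ⟨ht0, hxt0⟩, hleast⟩ := hcomp.exists_isLeast ⟨t, ⟨ht, le_rfl⟩, hcon⟩
  have hbefore : ∀ r, -τ ≤ r → r < t0 → 0 ≤ x r := by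
    intro r h1 h2
    rcases lt_or_ge r 0 with h3 | h3
    · exact h.x_nonneg r ⟨h1, h3⟩
    · by_contra h4
      have := hleast ⟨⟨h3, h2.le.trans ht0.2⟩, (not_le.mp h4).le⟩
      linarith
  have := h.comp_down (M := 0) le_rfl ht0.1 (fun r h1 h2 => h.rhs_ge_zero h1.le (fun j => by
    have hd := h.hdel j r h1.le
    exact hbefore _ (by linarith) (by linarith)))
  have h5 : 0 < x 0 * exp (-(D t0 - D 0)) := mul_pos h.x0 (exp_pos _)
  have h6 : x t0 ≤ 0 := hxt0
  linarith

lemma nonneg (h : Nich p a τd σd δ x D P τ am ap K C T0) : ∀ t ≥ -τ, 0 ≤ x t := by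
  intro t ht
  rcases lt_or_ge t 0 with h3 | h3
  · exact h.x_nonneg t ⟨ht, h3⟩
  · exact (h.pos t h3).le

lemma decay (h : Nich p a τd σd δ x D P τ am ap K C T0) {s t : ℝ} (hs : 0 ≤ s) (hst : s ≤ t) :
    x s * exp (-(D t - D s)) ≤ x t := by
  have := h.comp_down (M := 0) hs hst (fun r h1 h2 => h.rhs_ge_zero (by linarith) (fun j => by
    have hd := h.hdel j r (by linarith)
    exact h.nonneg _ (by linarith)))
  linarith

lemma D_mono (h : Nich p a τd σd δ x D P τ am ap K C T0) {s t : ℝ} (hs : 0 ≤ s) (hst : s ≤ t) :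
    D s ≤ D t := by
  have : MonotoneOn D (Icc s t) := by
    apply monotoneOn_of_deriv_nonneg (convex_Icc s t) (h.Dc hs)
    · intro r hr; rw [interior_Icc] at hr
      exact (h.hD r (by linarith [hr.1])).differentiableAt.differentiableWithinAt
    · intro r hr; rw [interior_Icc] at hr
      rw [(h.hD r (by linarith [hr.1])).deriv]
      exact (h.hδ r (by linarith [hr.1])).le
  exact this (left_mem_Icc.mpr hst) (right_mem_Icc.mpr hst) hst

lemma ap_pos (h : Nich p a τd σd δ x D P τ am ap K C T0) (j : Fin m) : 0 < ap := by
  have := h.ha j 0 le_rfl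
  linarith [h.ham]

lemma δ_le_p (h : Nich p a τd σd δ x D P τ am ap K C T0) {t : ℝ} (ht : 0 ≤ t) :
    δ t ≤ ∑ j, p j t := by
  rw [h.hK1 t ht]
  apply Finset.sum_le_sum
  intro j _
  have h1 : exp (-(a j t * K)) ≤ 1 := by
    apply exp_le_one_iff.mpr
    have := mul_pos (h.ham.trans_le (h.ha j t ht).1) h.hK
    linarith
  have := mul_le_mul_of_nonneg_left h1 (h.hp j t ht).le
  linarith

lemma D_le_P (h : Nich p a τd σd δ x D P τ am ap K C T0) {s t : ℝ} (hs : 0 ≤ s) (hst : s ≤ t) :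
    D t - D s ≤ P t - P s := by
  have hd : ∀ r ≥ 0, HasDerivAt (fun r => P r - D r) ((∑ j, p j r) - δ r) r := fun r hr =>
    (h.hP r hr).sub (h.hD r hr)
  have : MonotoneOn (fun r => P r - D r) (Icc s t) := by
    apply monotoneOn_of_deriv_nonneg (convex_Icc s t)
    · intro r hr
      exact (hd r (by linarith [hr.1])).continuousAt.continuousWithinAt
    · intro r hr; rw [interior_Icc] at hr
      exact (hd r (by linarith [hr.1])).differentiableAt.differentiableWithinAt
    · intro r hr; rw [interior_Icc] at hr
      rw [(hd r (by linarith [hr.1])).deriv]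
      linarith [h.δ_le_p (t := r) (by linarith [hr.1])]
  have := this (left_mem_Icc.mpr hst) (right_mem_Icc.mpr hst) hst
  simp only at this
  linarith

lemma P_mono (h : Nich p a τd σd δ x D P τ am ap K C T0) {s t : ℝ} (hs : 0 ≤ s) (hst : s ≤ t) :
    P s ≤ P t := by
  linarith [h.D_le_P hs hst, h.D_mono hs hst]

/-- Persistence. -/
lemma lower (h : Nich p a τd σd δ x D P τ am ap K C T0) : ∃ b > 0, ∀ t ≥ 0, b ≤ x t := by
  have hτ := h.hτ
  have hT0 := h.hT0
  obtain ⟨t1, ht1, hmin1⟩ := isCompact_Icc.exists_isMinOn (s := Icc 0 (T0 + τ))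
    ⟨0, le_rfl, by linarith⟩ (h.xc' le_rfl)
  have hK := h.hK
  refine ⟨min (x t1) (K / 2 * exp (-C)), lt_min (h.pos _ ht1.1) (by positivity), ?_⟩
  intro t ht
  obtain ⟨T, hT, hmin⟩ := isCompact_Icc.exists_isMinOn (s := Icc 0 t)
    ⟨0, le_rfl, ht⟩ (h.xc' le_rfl)
  have hxt : x T ≤ x t := hmin ⟨ht, le_rfl⟩
  refine le_trans ?_ hxt
  rcases le_or_gt T (T0 + τ) with hc | hc
  · exact (min_le_left _ _).trans (hmin1 ⟨hT.1, hc⟩)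
  apply (min_le_right _ _).trans
  have hmin' : ∀ r, 0 ≤ r → r ≤ T → x T ≤ x r := fun r h1 h2 => hmin ⟨h1, h2.trans hT.2⟩
  have hTp : 0 < T := by linarith
  have hd := deriv_nonpos_of_left_min hTp (h.hx T hTp) hmin'
  obtain ⟨j, hj⟩ : ∃ j, K / 2 ≤ x (T - σd j T) := by
    by_contra hcon
    push Not at hcon
    have h1 := h.rhs_ge (t := T) (B := x T) (c := am * (K / 2)) hT.1 (h.pos T hT.1).le
      (fun j => by
        have := h.hdel j T hT.1
        exact hmin' _ (by linarith) (by linarith))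
      (fun j => by
        have e1 := h.ha j T hT.1
        have e2 : am * (K / 2) ≤ a j T * (K / 2) := mul_le_mul_of_nonneg_right e1.1 (by linarith)
        have e3 : a j T * (K / 2) ≤ a j T * (K - x (T - σd j T)) :=
          mul_le_mul_of_nonneg_left (by linarith [hcon j]) (by linarith [h.ham])
        linarith)
    have h2 : 1 < exp (am * (K / 2)) := one_lt_exp_iff.mpr (mul_pos h.ham (by linarith))
    have h3 : 0 < δ T * (x T * exp (am * (K / 2)) - x T) := by
      apply mul_pos (h.hδ T hT.1)
      have := mul_lt_mul_of_pos_left h2 (h.pos T hT.1)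
      linarith
    linarith
  have hdl := h.hdel j T hT.1
  have h4 := h.decay (s := T - σd j T) (t := T) (by linarith) (by linarith)
  have h5 : D T - D (T - σd j T) ≤ C := by
    have e1 := h.D_le_P (s := T - σd j T) (t := T) (by linarith) (by linarith)
    have e2 := h.P_mono (s := T - τ) (t := T - σd j T) (by linarith) (by linarith)
    linarith [h.hC T (by linarith)]
  have h6 : exp (-C) ≤ exp (-(D T - D (T - σd j T))) := exp_le_exp.mpr (by linarith)
  have h7 := mul_le_mul hj h6 (exp_pos _).le (h.pos (T - σd j T) (by linarith)).le
  linarith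

/-- Boundedness. -/
lemma upper (h : Nich p a τd σd δ x D P τ am ap K C T0) : ∃ b, ∀ t ≥ 0, x t ≤ b := by
  have hτ := h.hτ
  have hT0 := h.hT0
  have hK := h.hK
  obtain ⟨t1, ht1, hmax1⟩ := isCompact_Icc.exists_isMaxOn (s := Icc 0 (T0 + 3 * τ))
    ⟨0, le_rfl, by linarith⟩ (h.xc' le_rfl)
  refine ⟨max (x t1) ((K + 1) * exp (2 * C) * exp (2 * C)), ?_⟩
  intro t ht
  obtain ⟨T, hT, hmax⟩ := isCompact_Icc.exists_isMaxOn (s := Icc 0 t)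
    ⟨0, le_rfl, ht⟩ (h.xc' le_rfl)
  have hxt : x t ≤ x T := hmax ⟨ht, le_rfl⟩
  refine le_trans hxt ?_
  rcases le_or_gt T (T0 + 3 * τ) with hc | hc
  · exact le_trans (hmax1 ⟨hT.1, hc⟩) (le_max_left _ _)
  refine le_trans ?_ (le_max_right _ _)
  have hmax' : ∀ r, 0 ≤ r → r ≤ T → x r ≤ x T := fun r h1 h2 => hmax ⟨h1, h2.trans hT.2⟩
  have hTp : 0 < T := by linarith
  have hd := deriv_nonneg_of_left_max hTp (h.hx T hTp) hmax'
  obtain ⟨j, hj⟩ : ∃ j, x (T - σd j T) ≤ K + 1 := by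
    by_contra hcon
    push Not at hcon
    have h1 := h.rhs_le (t := T) (B := x T) (c := -am) hT.1 (h.pos T hT.1).le
      (fun j => by
        have := h.hdel j T hT.1
        exact hmax' _ (by linarith) (by linarith))
      (fun j => by
        have e1 := h.ha j T hT.1
        have e3 : a j T * 1 ≤ a j T * (x (T - σd j T) - K) :=
          mul_le_mul_of_nonneg_left (by linarith [hcon j]) (by linarith [h.ham])
        linarith)
    have h2 : exp (-am) < 1 := exp_lt_one_iff.mpr (by linarith [h.ham])
    have h3 : 0 < δ T * (x T - x T * exp (-am)) := by
      apply mul_pos (h.hδ T hT.1)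
      have := mul_lt_mul_of_pos_left h2 (h.pos T hT.1)
      linarith
    linarith
  have hdl := h.hdel j T hT.1
  have hC1 := h.hC T (by linarith)
  have hC2 := h.hC (T - τ) (by linarith)
  -- bound on `[T - 2τ, T - τ]`
  have hb : ∀ s, T - 2 * τ ≤ s → s ≤ T - τ → x s ≤ (K + 1) * exp (2 * C) := by
    intro s h1 h2
    have h4 := h.decay (s := s) (t := T - σd j T) (by linarith) (by linarith)
    have h5 : D (T - σd j T) - D s ≤ 2 * C := by
      have e1 := h.D_le_P (s := s) (t := T - σd j T) (by linarith) (by linarith)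
      have e2 := h.P_mono (s := T - σd j T) (t := T) (by linarith) (by linarith)
      have e3 := h.P_mono (s := T - 2 * τ) (t := s) (by linarith) (by linarith)
      have e4 : T - τ - τ = T - 2 * τ := by ring
      rw [e4] at hC2
      linarith
    have h6 : exp (-(2 * C)) ≤ exp (-(D (T - σd j T) - D s)) := exp_le_exp.mpr (by linarith)
    have h7 := mul_le_mul_of_nonneg_left h6 (h.pos s (by linarith)).le
    have h8 : x s * exp (-(2 * C)) ≤ K + 1 := by linarith
    rw [exp_neg, ← div_eq_mul_inv, div_le_iff₀ (exp_pos _)] at h8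
    exact h8
  -- growth
  have hPc : ContinuousOn P (Icc (T - 2 * τ) T) := fun r hr =>
    (h.hP r (by linarith [hr.1])).continuousAt.continuousWithinAt
  obtain ⟨u, hu, humax⟩ := isCompact_Icc.exists_isMaxOn (s := Icc (T - 2 * τ) T)
    (f := fun r => x r * exp (-P r))
    ⟨T, by linarith, le_rfl⟩ ((h.xc' (by linarith)).mul (hPc.neg.rexp))
  have hub : u ≤ T - τ := by
    by_contra hcon
    rw [not_le] at hcon
    have hu0 : 0 < u := by linarith
    have hdu : HasDerivAt (fun r => x r * exp (-P r))
        (nrhs p a τd σd δ x u * exp (-P u) + x u * (exp (-P u) * (-(∑ j, p j u)))) u :=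
      (h.hx u hu0).mul (h.hP u hu0.le).neg.exp
    have h1 := deriv_nonneg_of_left_max (s := T - 2 * τ) (by linarith) hdu
      (fun r h1 h2 => humax ⟨h1, h2.trans hu.2⟩)
    have h2 : 0 ≤ (nrhs p a τd σd δ x u - x u * ∑ j, p j u) * exp (-P u) := by linarith
    have h3 : 0 ≤ nrhs p a τd σd δ x u - x u * ∑ j, p j u :=
      nonneg_of_mul_nonneg_left h2 (exp_pos _)
    have h4 : (∑ j, p j u * x (u - τd j u) * Real.exp (-(a j u * x (u - σd j u)))) ≤
        x u * ∑ j, p j u := by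
      rw [Finset.mul_sum]
      apply Finset.sum_le_sum
      intro i _
      have hdi := h.hdel i u hu0.le
      have e1 : x (u - τd i u) * exp (-P (u - τd i u)) ≤ x u * exp (-P u) :=
        humax ⟨by linarith, by linarith [hu.2]⟩
      have e2 : exp (-P u) ≤ exp (-P (u - τd i u)) :=
        exp_le_exp.mpr (neg_le_neg (h.P_mono (by linarith) (by linarith)))
      have e3 : x (u - τd i u) ≤ x u := by
        have := mul_le_mul_of_nonneg_left e2 (h.pos u hu0.le).le
        exact le_of_mul_le_mul_right (e1.trans this) (exp_pos _)
      have e4 : exp (-(a i u * x (u - σd i u))) ≤ 1 := by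
        apply exp_le_one_iff.mpr
        have := mul_nonneg (h.ham.le.trans (h.ha i u hu0.le).1)
          (h.nonneg (u - σd i u) (by linarith))
        linarith
      have e5 : 0 ≤ p i u * x (u - τd i u) :=
        mul_nonneg (h.hp i u hu0.le).le (h.nonneg _ (by linarith))
      calc _ ≤ p i u * x (u - τd i u) * 1 := mul_le_mul_of_nonneg_left e4 e5
        _ ≤ p i u * x u * 1 := by
          rw [mul_one, mul_one]; exact mul_le_mul_of_nonneg_left e3 (h.hp i u hu0.le).le
        _ = _ := by ring
    have h5 := mul_pos (h.hδ u hu0.le) (h.pos u hu0.le)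
    unfold nrhs at h3
    linarith
  have hfin : x T * exp (-P T) ≤ x u * exp (-P u) := humax ⟨by linarith, le_rfl⟩
  have hfin2 : x T ≤ x u * exp (P T - P u) := by
    have e : exp (P T - P u) = exp (-P u) / exp (-P T) := by rw [← exp_sub]; congr 1; ring
    rw [e, mul_div_assoc', le_div_iff₀ (exp_pos _)]
    exact hfin
  have h9 : P T - P u ≤ 2 * C := by
    have e3 := h.P_mono (s := T - 2 * τ) (t := u) (by linarith) hu.1
    have e4 : T - τ - τ = T - 2 * τ := by ring
    rw [e4] at hC2
    linarith
  have h10 : exp (P T - P u) ≤ exp (2 * C) := exp_le_exp.mpr h9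
  have h11 := mul_le_mul (hb u hu.1 hub) h10 (exp_pos _).le (by positivity)
  linarith


lemma up_exists (h : Nich p a τd σd δ x D P τ am ap K C T0) {L : ℝ} (hL : 0 < L)
    (hLu : ∀ ε > 0, ∀ᶠ t in atTop, x t ≤ L + ε) (hLf : ∀ ε > 0, ∃ᶠ t in atTop, L - ε < x t)
    {η : ℝ} (hη : 0 < η) :
    ∀ᶠ ε in nhdsWithin (0:ℝ) (Ioi 0), ∀ T, ∃ t ≥ T, L - ε ≤ x t ∧
      ∃ j, x (t - σd j t) < K + η := by
  have hτ := h.hτ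
  have ev : ∀ᶠ ε in nhdsWithin (0:ℝ) (Ioi 0), (L + ε) * exp (-(am * η)) < L - 2 * ε := by
    apply Filter.Eventually.filter_mono nhdsWithin_le_nhds
    have c1 : Continuous (fun ε : ℝ => (L + ε) * exp (-(am * η))) := by fun_prop
    have c2 : Continuous (fun ε : ℝ => L - 2 * ε) := by fun_prop
    apply (c1.tendsto 0).eventually_lt (c2.tendsto 0)
    have h2 : exp (-(am * η)) < 1 := exp_lt_one_iff.mpr (by linarith [mul_pos h.ham hη])
    have := mul_lt_mul_of_pos_left h2 hL
    simp only [add_zero, mul_zero, sub_zero]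
    linarith
  filter_upwards [ev, self_mem_nhdsWithin] with ε hε hε0 T
  have hε0 : 0 < ε := hε0
  obtain ⟨T1, hT1⟩ := eventually_atTop.mp (hLu ε hε0)
  obtain ⟨t, ht, hxt, hdt⟩ := fluct_up hε0 h.hx (fun r hr => h.hD r (le_of_lt hr))
    (fun r hr => h.hδ r (le_of_lt hr)) h.hDt (hLf ε hε0) (max T (max 0 T1 + τ + 1))
    (lt_of_lt_of_le (by linarith [le_max_left 0 T1]) (le_max_right _ _))
  have ht1 : T ≤ t := le_trans (le_max_left _ _) ht
  have ht2 : max 0 T1 + τ + 1 ≤ t := le_trans (le_max_right _ _) ht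
  have ht3 := le_max_left 0 T1
  have ht4 := le_max_right 0 T1
  have htp : 0 ≤ t := by linarith
  refine ⟨t, ht1, hxt, ?_⟩
  by_contra hcon
  push Not at hcon
  have h1 := h.rhs_le (t := t) (B := L + ε) (c := -(am * η)) htp (by linarith)
    (fun j => by
      have := h.hdel j t htp
      exact hT1 _ (by linarith))
    (fun j => by
      have e1 := h.ha j t htp
      have e2 : am * η ≤ a j t * η := mul_le_mul_of_nonneg_right e1.1 hη.le
      have e3 : a j t * η ≤ a j t * (x (t - σd j t) - K) :=
        mul_le_mul_of_nonneg_left (by linarith [hcon j]) (by linarith [h.ham])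
      linarith)
  have h3 : 0 < δ t * (x t - ε - (L + ε) * exp (-(am * η))) :=
    mul_pos (h.hδ t htp) (by linarith)
  linarith

lemma down_exists (h : Nich p a τd σd δ x D P τ am ap K C T0) {l : ℝ} (hl : 0 < l)
    (hll : ∀ ε > 0, ∀ᶠ t in atTop, l - ε ≤ x t) (hlf : ∀ ε > 0, ∃ᶠ t in atTop, x t < l + ε)
    {η : ℝ} (hη : 0 < η) :
    ∀ᶠ ε in nhdsWithin (0:ℝ) (Ioi 0), ∀ T, ∃ t ≥ T, x t ≤ l + ε ∧
      ∃ j, K - η < x (t - σd j t) := by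
  have hτ := h.hτ
  have ev : ∀ᶠ ε in nhdsWithin (0:ℝ) (Ioi 0), l + 2 * ε < (l - ε) * exp (am * η) := by
    apply Filter.Eventually.filter_mono nhdsWithin_le_nhds
    have c1 : Continuous (fun ε : ℝ => (l - ε) * exp (am * η)) := by fun_prop
    have c2 : Continuous (fun ε : ℝ => l + 2 * ε) := by fun_prop
    apply (c2.tendsto 0).eventually_lt (c1.tendsto 0)
    have h2 : 1 < exp (am * η) := one_lt_exp_iff.mpr (mul_pos h.ham hη)
    have := mul_lt_mul_of_pos_left h2 hl
    simp only [add_zero, mul_zero, sub_zero]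
    linarith
  have ev2 : ∀ᶠ ε in nhdsWithin (0:ℝ) (Ioi 0), ε < l :=
    Filter.Eventually.filter_mono nhdsWithin_le_nhds (eventually_lt_nhds hl)
  filter_upwards [ev, ev2, self_mem_nhdsWithin] with ε hε hεl hε0 T
  have hε0 : 0 < ε := hε0
  obtain ⟨T1, hT1⟩ := eventually_atTop.mp (hll ε hε0)
  obtain ⟨t, ht, hxt, hdt⟩ := fluct_down hε0 h.hx (fun r hr => h.hD r (le_of_lt hr))
    (fun r hr => h.hδ r (le_of_lt hr)) h.hDt (hlf ε hε0) (max T (max 0 T1 + τ + 1))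
    (lt_of_lt_of_le (by linarith [le_max_left 0 T1]) (le_max_right _ _))
  have ht1 : T ≤ t := le_trans (le_max_left _ _) ht
  have ht2 : max 0 T1 + τ + 1 ≤ t := le_trans (le_max_right _ _) ht
  have ht3 := le_max_left 0 T1
  have ht4 := le_max_right 0 T1
  have htp : 0 ≤ t := by linarith
  refine ⟨t, ht1, hxt, ?_⟩
  by_contra hcon
  push Not at hcon
  have h1 := h.rhs_ge (t := t) (B := l - ε) (c := am * η) htp (by linarith)
    (fun j => by
      have := h.hdel j t htp
      exact hT1 _ (by linarith))
    (fun j => by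
      have e1 := h.ha j t htp
      have e2 : am * η ≤ a j t * η := mul_le_mul_of_nonneg_right e1.1 hη.le
      have e3 : a j t * η ≤ a j t * (K - x (t - σd j t)) :=
        mul_le_mul_of_nonneg_left (by linarith [hcon j]) (by linarith [h.ham])
      linarith)
  have h3 : 0 < δ t * ((l - ε) * exp (am * η) - (x t + ε)) :=
    mul_pos (h.hδ t htp) (by linarith)
  linarith

lemma l_le_K (h : Nich p a τd σd δ x D P τ am ap K C T0) {L l : ℝ} (hL : 0 < L)
    (hLu : ∀ ε > 0, ∀ᶠ t in atTop, x t ≤ L + ε) (hLf : ∀ ε > 0, ∃ᶠ t in atTop, L - ε < x t)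
    (hll : ∀ ε > 0, ∀ᶠ t in atTop, l - ε ≤ x t) : l ≤ K := by
  apply le_of_forall_pos_le_add
  intro η hη
  obtain ⟨ε, hε⟩ := (h.up_exists hL hLu hLf (half_pos hη)).exists
  obtain ⟨T1, hT1⟩ := eventually_atTop.mp (hll (η / 2) (half_pos hη))
  obtain ⟨t, ht, -, j, hj⟩ := hε (max 0 (T1 + τ))
  have h1 := le_trans (le_max_left _ _) ht
  have h2 := le_trans (le_max_right _ _) ht
  have := hT1 (t - σd j t) (by linarith [h.hdel j t h1])
  linarith

lemma K_le_L (h : Nich p a τd σd δ x D P τ am ap K C T0) {L l : ℝ} (hl : 0 < l)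
    (hll : ∀ ε > 0, ∀ᶠ t in atTop, l - ε ≤ x t) (hlf : ∀ ε > 0, ∃ᶠ t in atTop, x t < l + ε)
    (hLu : ∀ ε > 0, ∀ᶠ t in atTop, x t ≤ L + ε) : K ≤ L := by
  apply le_of_forall_pos_le_add
  intro η hη
  obtain ⟨ε, hε⟩ := (h.down_exists hl hll hlf (half_pos hη)).exists
  obtain ⟨T1, hT1⟩ := eventually_atTop.mp (hLu (η / 2) (half_pos hη))
  obtain ⟨t, ht, -, j, hj⟩ := hε (max 0 (T1 + τ))
  have h1 := le_trans (le_max_left _ _) ht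
  have h2 := le_trans (le_max_right _ _) ht
  have := hT1 (t - σd j t) (by linarith [h.hdel j t h1])
  linarith

lemma up_ineq (h : Nich p a τd σd δ x D P τ am ap K C T0) {L l ζ : ℝ} (hlK : l ≤ K) (hKL : K ≤ L)
    (hLu : ∀ ε > 0, ∀ᶠ t in atTop, x t ≤ L + ε) (hLf : ∀ ε > 0, ∃ᶠ t in atTop, L - ε < x t)
    (hll : ∀ ε > 0, ∀ᶠ t in atTop, l - ε ≤ x t)
    (hζ : ∀ ε > 0, ∀ᶠ t in atTop, ∀ j, D t - D (t - σd j t) ≤ ζ + ε) :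
    L ≤ K + (L * exp (ap * (K - l)) - K) * (1 - exp (-ζ)) := by
  have hτ := h.hτ
  have hK := h.hK
  apply le_of_forall_pos_le_add
  intro η hη
  have ev : ∀ᶠ ε in nhdsWithin (0:ℝ) (Ioi 0), L - ε ≤
      K + ((L + ε) * exp (ap * (K - l + ε)) - K) * (1 - exp (-(ζ + ε))) + η := by
    filter_upwards [h.up_exists (by linarith) hLu hLf hη, self_mem_nhdsWithin] with ε hε hε0
    have hε0 : 0 < ε := hε0
    obtain ⟨T1, hT1⟩ := eventually_atTop.mp ((hLu ε hε0).and ((hll ε hε0).and (hζ ε hε0)))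
    obtain ⟨t, ht, hxt, j, hj⟩ := hε (max 0 T1 + 2 * τ)
    have ht3 := le_max_left 0 T1
    have ht4 := le_max_right 0 T1
    have htp : 0 ≤ t := by linarith
    have hdj := h.hdel j t htp
    have hap := h.ap_pos j
    set M := (L + ε) * exp (ap * (K - l + ε)) with hM
    have hKM : K ≤ M := by
      have : 1 ≤ exp (ap * (K - l + ε)) := one_le_exp (mul_nonneg hap.le (by linarith))
      have := mul_le_mul_of_nonneg_left this (show 0 ≤ L + ε by linarith)
      linarith
    have h1 := h.comp_up (s := t - σd j t) (t := t) (M := M) (by linarith) (by linarith)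
      (fun r hr1 hr2 => h.rhs_le (by linarith) (by linarith)
        (fun i => by
          have hdi := h.hdel i r (by linarith)
          exact (hT1 _ (by linarith)).1)
        (fun i => by
          have hdi := h.hdel i r (by linarith)
          have e0 := (hT1 (r - σd i r) (by linarith)).2.1
          have e1 := h.ha i r (by linarith)
          have e2 : a i r * (K - x (r - σd i r)) ≤ a i r * (K - l + ε) :=
            mul_le_mul_of_nonneg_left (by linarith) (by linarith [h.ham])
          have e3 : a i r * (K - l + ε) ≤ ap * (K - l + ε) :=
            mul_le_mul_of_nonneg_right e1.2 (by linarith)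
          linarith))
    have h2 := (hT1 t (by linarith)).2.2 j
    have h3 : exp (-(ζ + ε)) ≤ exp (-(D t - D (t - σd j t))) := exp_le_exp.mpr (by linarith)
    have h4 : exp (-(D t - D (t - σd j t))) ≤ 1 := exp_le_one_iff.mpr (by
      linarith [h.D_mono (s := t - σd j t) (t := t) (by linarith) (by linarith)])
    set E := exp (-(D t - D (t - σd j t))) with hE
    have hE0 : 0 < E := exp_pos _
    have h5 : (x (t - σd j t) - K) * E ≤ η := by
      have := mul_le_mul_of_nonneg_right (show x (t - σd j t) - K ≤ η by linarith) hE0.le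
      have := mul_le_mul_of_nonneg_left h4 hη.le
      linarith
    have h6 := mul_le_mul_of_nonneg_left h3 (show 0 ≤ M - K by linarith)
    linarith
  have c1 : Continuous (fun ε : ℝ => L - ε) := by fun_prop
  have c2 : Continuous (fun ε : ℝ =>
    K + ((L + ε) * exp (ap * (K - l + ε)) - K) * (1 - exp (-(ζ + ε))) + η) := by fun_prop
  have := le_of_tendsto_of_tendsto ((c1.tendsto 0).mono_left nhdsWithin_le_nhds)
    ((c2.tendsto 0).mono_left nhdsWithin_le_nhds) ev
  simpa using this

lemma down_ineq (h : Nich p a τd σd δ x D P τ am ap K C T0) {L l ζ : ℝ} (hl : 0 < l)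
    (hlK : l ≤ K) (hKL : K ≤ L)
    (hLu : ∀ ε > 0, ∀ᶠ t in atTop, x t ≤ L + ε) (hlf : ∀ ε > 0, ∃ᶠ t in atTop, x t < l + ε)
    (hll : ∀ ε > 0, ∀ᶠ t in atTop, l - ε ≤ x t)
    (hζ : ∀ ε > 0, ∀ᶠ t in atTop, ∀ j, D t - D (t - σd j t) ≤ ζ + ε) :
    K - (K - l * exp (-(ap * (L - K)))) * (1 - exp (-ζ)) ≤ l := by
  have hτ := h.hτ
  have hK := h.hK
  apply le_of_forall_pos_le_add
  intro η hη
  have ev2 : ∀ᶠ ε in nhdsWithin (0:ℝ) (Ioi 0), ε < l :=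
    Filter.Eventually.filter_mono nhdsWithin_le_nhds (eventually_lt_nhds hl)
  have ev : ∀ᶠ ε in nhdsWithin (0:ℝ) (Ioi 0),
      K - (K - (l - ε) * exp (-(ap * (L + ε - K)))) * (1 - exp (-(ζ + ε))) ≤ l + ε + η := by
    filter_upwards [h.down_exists hl hll hlf hη, ev2, self_mem_nhdsWithin] with ε hε hεl hε0
    have hε0 : 0 < ε := hε0
    obtain ⟨T1, hT1⟩ := eventually_atTop.mp ((hLu ε hε0).and ((hll ε hε0).and (hζ ε hε0)))
    obtain ⟨t, ht, hxt, j, hj⟩ := hε (max 0 T1 + 2 * τ)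
    have ht3 := le_max_left 0 T1
    have ht4 := le_max_right 0 T1
    have htp : 0 ≤ t := by linarith
    have hdj := h.hdel j t htp
    have hap := h.ap_pos j
    set M := (l - ε) * exp (-(ap * (L + ε - K))) with hM
    have hKM : M ≤ K := by
      have : exp (-(ap * (L + ε - K))) ≤ 1 := exp_le_one_iff.mpr (by
        linarith [mul_nonneg hap.le (show 0 ≤ L + ε - K by linarith)])
      have := mul_le_mul_of_nonneg_left this (show 0 ≤ l - ε by linarith)
      linarith
    have h1 := h.comp_down (s := t - σd j t) (t := t) (M := M) (by linarith) (by linarith)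
      (fun r hr1 hr2 => h.rhs_ge (by linarith) (by linarith)
        (fun i => by
          have hdi := h.hdel i r (by linarith)
          exact (hT1 _ (by linarith)).2.1)
        (fun i => by
          have hdi := h.hdel i r (by linarith)
          have e0 := (hT1 (r - σd i r) (by linarith)).1
          have e1 := h.ha i r (by linarith)
          have e2 : a i r * (x (r - σd i r) - K) ≤ a i r * (L + ε - K) :=
            mul_le_mul_of_nonneg_left (by linarith) (by linarith [h.ham])
          have e3 : a i r * (L + ε - K) ≤ ap * (L + ε - K) :=
            mul_le_mul_of_nonneg_right e1.2 (by linarith)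
          linarith))
    have h2 := (hT1 t (by linarith)).2.2 j
    have h3 : exp (-(ζ + ε)) ≤ exp (-(D t - D (t - σd j t))) := exp_le_exp.mpr (by linarith)
    have h4 : exp (-(D t - D (t - σd j t))) ≤ 1 := exp_le_one_iff.mpr (by
      linarith [h.D_mono (s := t - σd j t) (t := t) (by linarith) (by linarith)])
    set E := exp (-(D t - D (t - σd j t))) with hE
    have hE0 : 0 < E := exp_pos _
    have h5 : (K - x (t - σd j t)) * E ≤ η := by
      have := mul_le_mul_of_nonneg_right (show K - x (t - σd j t) ≤ η by linarith) hE0.le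
      have := mul_le_mul_of_nonneg_left h4 hη.le
      linarith
    have h6 := mul_le_mul_of_nonneg_left h3 (show 0 ≤ K - M by linarith)
    linarith
  have c1 : Continuous (fun ε : ℝ => l + ε + η) := by fun_prop
  have c2 : Continuous (fun ε : ℝ =>
    K - (K - (l - ε) * exp (-(ap * (L + ε - K)))) * (1 - exp (-(ζ + ε)))) := by fun_prop
  have := le_of_tendsto_of_tendsto ((c2.tendsto 0).mono_left nhdsWithin_le_nhds)
    ((c1.tendsto 0).mono_left nhdsWithin_le_nhds) ev
  simpa using this

lemma tendsto_K (h : Nich p a τd σd δ x D P τ am ap K C T0) {ζ : ℝ} (hap : 0 < ap)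
    (hζ : ∀ ε > 0, ∀ᶠ t in atTop, ∀ j, D t - D (t - σd j t) ≤ ζ + ε)
    (hθ : ap * K * (exp ζ - 1) ≤ 1) : Tendsto x atTop (nhds K) := by
  obtain ⟨b, hb, hbx⟩ := h.lower
  obtain ⟨B, hBx⟩ := h.upper
  have ev1 : ∀ᶠ t in atTop, b ≤ x t := by
    filter_upwards [eventually_ge_atTop 0] with t ht using hbx t ht
  have ev2 : ∀ᶠ t in atTop, x t ≤ B := by
    filter_upwards [eventually_ge_atTop 0] with t ht using hBx t ht
  have bd1 : IsBoundedUnder (· ≥ ·) atTop x := ⟨b, ev1⟩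
  have bd2 : IsBoundedUnder (· ≤ ·) atTop x := ⟨B, ev2⟩
  have hl : 0 < liminf x atTop := lt_of_lt_of_le hb (le_liminf_of_le bd2.isCoboundedUnder_ge ev1)
  have hlL : liminf x atTop ≤ limsup x atTop := liminf_le_limsup bd2 bd1
  have hLu : ∀ ε > 0, ∀ᶠ t in atTop, x t ≤ limsup x atTop + ε := fun ε hε =>
    (eventually_lt_of_limsup_lt (lt_add_of_pos_right _ hε) bd2).mono (fun _ h => le_of_lt h)
  have hll : ∀ ε > 0, ∀ᶠ t in atTop, liminf x atTop - ε ≤ x t := fun ε hε =>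
    (eventually_lt_of_lt_liminf (sub_lt_self _ hε) bd1).mono (fun _ h => le_of_lt h)
  have hLf : ∀ ε > 0, ∃ᶠ t in atTop, limsup x atTop - ε < x t := fun ε hε =>
    frequently_lt_of_lt_limsup bd1.isCoboundedUnder_le (sub_lt_self _ hε)
  have hlf : ∀ ε > 0, ∃ᶠ t in atTop, x t < liminf x atTop + ε := fun ε hε =>
    frequently_lt_of_liminf_lt bd2.isCoboundedUnder_ge (lt_add_of_pos_right _ hε)
  generalize hLdef : limsup x atTop = L at *
  generalize hldef : liminf x atTop = l at *
  have hlK := h.l_le_K (by linarith) hLu hLf hll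
  have hKL := h.K_le_L hl hll hlf hLu
  have hU := h.up_ineq hlK hKL hLu hLf hll hζ
  have hD := h.down_ineq hl hlK hKL hLu hlf hll hζ
  have hee : exp ζ * exp (-ζ) = 1 := by rw [← exp_add]; simp
  obtain ⟨e1, e2⟩ := scalar_final ap K l L (exp ζ - 1) hap h.hK hl hlK hKL hθ
    (by
      have := mul_le_mul_of_nonneg_left hU (exp_pos ζ).le
      have e : exp ζ * (K + (L * exp (ap * (K - l)) - K) * (1 - exp (-ζ))) =
        K + L * exp (ap * (K - l)) * (exp ζ - 1) := by
        linear_combination (-(L * exp (ap * (K - l)) - K)) * hee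
      rw [e] at this; linarith)
    (by
      have := mul_le_mul_of_nonneg_left hD (exp_pos ζ).le
      have e : exp ζ * (K - (K - l * exp (-(ap * (L - K)))) * (1 - exp (-ζ))) =
        K + l * exp (-(ap * (L - K))) * (exp ζ - 1) := by
        linear_combination (K - l * exp (-(ap * (L - K)))) * hee
      rw [e] at this; linarith)
  exact tendsto_of_liminf_eq_limsup (hldef.trans e1) (hLdef.trans e2) bd2 bd1

end Nich

/-- Primitive of a function continuous on `[0,∞)`. -/
lemma exists_primitive {f : ℝ → ℝ} (hf : ContinuousOn f (Ici 0)) :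
    ∃ F : ℝ → ℝ, (∀ t ≥ 0, HasDerivAt F (f t) t) ∧
      ∀ s t, 0 ≤ s → 0 ≤ t → F t - F s = ∫ r in s..t, f r := by
  have hc : Continuous (fun s => f (max s 0)) :=
    hf.comp_continuous (by fun_prop) (fun s => le_max_right s 0)
  refine ⟨fun t => ∫ s in (0:ℝ)..t, f (max s 0), ?_, ?_⟩
  · intro t ht
    have := hc.integral_hasStrictDerivAt 0 t
    have h2 := this.hasDerivAt
    rwa [max_eq_left ht] at h2
  · intro s t hs ht
    rw [intervalIntegral.integral_interval_sub_left (hc.intervalIntegrable _ _)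
      (hc.intervalIntegrable _ _)]
    apply intervalIntegral.integral_congr
    intro r hr
    have : 0 ≤ r := (le_min hs ht).trans hr.1
    simp only [max_eq_left this]

/-- Under (A0)--(A3), (K1) and (K2*) `(a⁺/a⁻)(e^{ζ⁺} - 1) log γ ≤ 1`, where
`ζ⁺ = max_j limsup_{t→∞} ∫_{t-σ_j(t)}^t δ(s) ds` and `γ = limsup_{t→∞} p(t)/δ(t)`,
the positive equilibrium `K` of (*) is globally attractive. -/
theorem global_attractivity_of_equilibrium_K2star
    (m : ℕ) (hm : 0 < m) (p a : Fin m → ℝ → ℝ) (δ : ℝ → ℝ)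
    (τd σd : Fin m → ℝ → ℝ) (τ : ℝ)
    (hA0 : HypA0 m p a δ τd σd) (hτ : IsMaxDelay m τd σd τ)
    (hA1 : HypA1 m p δ) (hA2 : HypA2 m p τ) (hA3 : HypA3 δ)
    (aminus aplus : ℝ)
    (haminus : IsGLB {r : ℝ | ∃ j : Fin m, ∃ t : ℝ, 0 ≤ t ∧ r = a j t} aminus)
    (haplus : IsLUB {r : ℝ | ∃ j : Fin m, ∃ t : ℝ, 0 ≤ t ∧ r = a j t} aplus)
    (K : ℝ) (hKpos : 0 < K)
    (hK1 : ∀ t ≥ (0:ℝ), δ t = ∑ j, p j t * Real.exp (-(a j t * K)))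
    (γ : ℝ)
    (hγ : γ = Filter.limsup (fun t => (∑ j, p j t) / δ t) Filter.atTop)
    (ζplus : ℝ)
    (hζ : IsGreatest {r : ℝ | ∃ j : Fin m,
        r = Filter.limsup (fun t => ∫ s in (t - σd j t)..t, δ s) Filter.atTop} ζplus)
    (hK2star : (aplus / aminus) * (Real.exp ζplus - 1) * Real.log γ ≤ 1) :
    ∀ x : ℝ → ℝ, IsPosSol m p a δ τd σd τ x →
      Filter.Tendsto x Filter.atTop (nhds K) := by
  intro x hxs
  obtain ⟨hp, haa, ⟨hδc, hδ⟩, hdel⟩ := hA0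
  obtain ⟨xc, xnn, x0, hx⟩ := hxs
  have hne : Nonempty (Fin m) := ⟨⟨0, hm⟩⟩
  have ha : ∀ j, ∀ t ≥ 0, aminus ≤ a j t ∧ a j t ≤ aplus := fun j t ht =>
    ⟨haminus.1 ⟨j, t, ht, rfl⟩, haplus.1 ⟨j, t, ht, rfl⟩⟩
  have ham : 0 < aminus := by
    choose c Cc hc using fun j => (haa j).2
    obtain ⟨j0, hj0⟩ := Finite.exists_min c
    refine lt_of_lt_of_le (hc j0).1 (haminus.2 ?_)
    rintro r ⟨j, t, ht, rfl⟩
    exact (hj0 j).trans ((hc j).2 t ht).1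
  have hdel' : ∀ j, ∀ t ≥ 0, 0 ≤ τd j t ∧ τd j t ≤ τ ∧ 0 ≤ σd j t ∧ σd j t ≤ τ := by
    intro j t ht
    have h1 := (hdel j).2.2.1 t ht
    exact ⟨h1.1, hτ.1 ⟨j, t, ht, Or.inl rfl⟩, h1.2, hτ.1 ⟨j, t, ht, Or.inr rfl⟩⟩
  have hτ0 : 0 ≤ τ := by
    have := hdel' ⟨0, hm⟩ 0 le_rfl
    linarith
  have hap : 0 < aplus := by
    have := ha ⟨0, hm⟩ 0 le_rfl
    linarith
  obtain ⟨D, hD, hDi⟩ := exists_primitive hδc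
  obtain ⟨P, hP, hPi⟩ := exists_primitive (f := fun t => ∑ j, p j t)
    (continuousOn_finsetSum _ (fun j _ => (hp j).1))
  have hDt : Tendsto D atTop atTop := by
    have h1 : Tendsto (fun t => D 0 + ∫ s in (0:ℝ)..t, δ s) atTop atTop :=
      tendsto_atTop_add_const_left _ _ hA3
    refine h1.congr' ?_
    filter_upwards [eventually_ge_atTop 0] with t ht
    rw [← hDi 0 t le_rfl ht]; ring
  obtain ⟨C, hC⟩ := hA2
  rw [eventually_map] at hC
  obtain ⟨T1, hT1⟩ := eventually_atTop.mp hC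
  have hN : Nich p a τd σd δ x D P τ aminus aplus K C (max τ T1) :=
    { hp := fun j => (hp j).2
      ham := ham
      ha := ha
      hδ := hδ
      hτ := hτ0
      hdel := hdel'
      hK := hKpos
      hK1 := hK1
      hD := hD
      hP := hP
      hDt := hDt
      hT0 := hτ0.trans (le_max_left _ _)
      hC := by
        intro t ht
        have h1 := (le_max_left _ _).trans ht
        have h2 := (le_max_right _ _).trans ht
        rw [hPi (t - τ) t (by linarith) (by linarith)]
        exact hT1 t h2
      xc := xc
      x_nonneg := xnn
      x0 := x0
      hx := fun t ht => (hx t (le_of_lt ht)).hasDerivAt (Ici_mem_nhds ht) }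
  have hζ' : ∀ ε > 0, ∀ᶠ t in atTop, ∀ j, D t - D (t - σd j t) ≤ ζplus + ε := by
    intro ε hε
    rw [eventually_all]
    intro j
    have hle : limsup (fun t => ∫ s in (t - σd j t)..t, δ s) atTop < ζplus + ε := by
      have := hζ.2 ⟨j, rfl⟩
      linarith
    have heq : ∀ t ≥ τ, D t - D (t - σd j t) = ∫ s in (t - σd j t)..t, δ s := by
      intro t ht
      have := hdel' j t (by linarith)
      exact hDi _ _ (by linarith) (by linarith)
    have hbd : IsBoundedUnder (· ≤ ·) atTop (fun t => ∫ s in (t - σd j t)..t, δ s) := by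
      refine ⟨C, ?_⟩
      rw [eventually_map]
      filter_upwards [eventually_ge_atTop (max τ T1)] with t ht
      have h1 := (le_max_left _ _).trans ht
      have h3 := hdel' j t (by linarith)
      rw [← heq t h1]
      have e1 := hN.D_le_P (s := t - σd j t) (t := t) (by linarith) (by linarith)
      have e2 := hN.P_mono (s := t - τ) (t := t - σd j t) (by linarith) (by linarith)
      have e3 := hN.hC t ht
      linarith
    filter_upwards [eventually_lt_of_limsup_lt hle hbd, eventually_ge_atTop τ] with t h1 h2
    rw [heq t h2]
    exact h1.le
  have hθ : aplus * K * (exp ζplus - 1) ≤ 1 := by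
    rcases le_or_gt (exp ζplus - 1) 0 with h0 | h0
    · have := mul_nonpos_of_nonneg_of_nonpos (mul_pos hap hKpos).le h0
      linarith
    have hγ1 : exp (aminus * K) ≤ γ := by
      rw [hγ]
      apply le_limsup_of_frequently_le _ hA1.2
      apply Eventually.frequently
      filter_upwards [eventually_ge_atTop 0] with t ht
      rw [le_div_iff₀ (hδ t ht), hK1 t ht, Finset.mul_sum]
      apply Finset.sum_le_sum
      intro j _
      have e1 : exp (aminus * K) * exp (-(a j t * K)) ≤ 1 := by
        rw [← exp_add]
        apply exp_le_one_iff.mpr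
        have := mul_le_mul_of_nonneg_right (ha j t ht).1 hKpos.le
        linarith
      have := mul_le_mul_of_nonneg_left e1 ((hp j).2 t ht).le
      linarith
    have hlog : aminus * K ≤ log γ := by
      rw [le_log_iff_exp_le (lt_of_lt_of_le (exp_pos _) hγ1)]
      exact hγ1
    have h1 : (aplus / aminus) * (exp ζplus - 1) * (aminus * K) ≤
        (aplus / aminus) * (exp ζplus - 1) * log γ :=
      mul_le_mul_of_nonneg_left hlog (mul_pos (div_pos hap ham) h0).le
    have h2 : (aplus / aminus) * (exp ζplus - 1) * (aminus * K) =
        aplus * K * (exp ζplus - 1) := by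
      field_simp
    linarith
  exact hN.tendsto_K hap hζ' hθ
end
end
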